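/- arXiv:math/9201230 — 2 statements merged into one kernel-verified Lean document; each statement's English description precedes it below -/
import Mathlib

section
/- Let (e_i) be a normalized unconditional basis of a reflexive Banach space E, let X = J(e_i) be the James-type space over (e_i) with canonical basis (u_i) and summing functional S. Let (y_n) be a bounded sequence in X with no weakly convergent subsequence. Then there exist a strictly increasing sequence (n_i) of indices, an element y_0 ∈ X, a block basis (z_i) of (u_n), and a real number a ≠ 0 such that the sequence (y_{n_i} − y_0) is equivalent to (z_i) and S(z_i) = a for all i. -/
open Filter Topology

noncomputable section

/-- An operator between normed spaces is *weakly compact* if the image of the closed unit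
ball is relatively compact in the weak topology of the codomain. -/
def IsWeaklyCompactOperator {X Y : Type*} [NormedAddCommGroup X] [NormedSpace ℝ X]
    [NormedAddCommGroup Y] [NormedSpace ℝ Y] (T : X →L[ℝ] Y) : Prop :=
  IsCompact (closure (toWeakSpace ℝ Y '' (T '' Metric.closedBall 0 1)))

/-- An operator between normed spaces is *compact* if the image of the closed unit ball is
relatively norm-compact. -/
def IsCompactOp {X Y : Type*} [NormedAddCommGroup X] [NormedSpace ℝ X]
    [NormedAddCommGroup Y] [NormedSpace ℝ Y] (T : X →L[ℝ] Y) : Prop :=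
  IsCompact (closure (T '' Metric.closedBall 0 1))

/-- A Banach space has *Property (w)* if every operator into its dual is weakly compact. -/
def PropertyW (X : Type*) [NormedAddCommGroup X] [NormedSpace ℝ X] : Prop :=
  ∀ T : X →L[ℝ] (X →L[ℝ] ℝ), IsWeaklyCompactOperator T

/-- A normed space is *weakly sequentially complete* if every weakly Cauchy sequence is
weakly convergent. -/
def WeaklySeqComplete (X : Type*) [NormedAddCommGroup X] [NormedSpace ℝ X] : Prop :=
  ∀ x : ℕ → X,
    (∀ f : X →L[ℝ] ℝ, ∃ L : ℝ, Tendsto (fun n => f (x n)) atTop (𝓝 L)) →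
    ∃ x₀ : X, ∀ f : X →L[ℝ] ℝ, Tendsto (fun n => f (x n)) atTop (𝓝 (f x₀))

/-- A normed space is reflexive if the canonical embedding into the double dual is
surjective. -/
def IsReflexiveSpace (X : Type*) [NormedAddCommGroup X] [NormedSpace ℝ X] : Prop :=
  Function.Surjective (NormedSpace.inclusionInDoubleDual ℝ X)

/-- `(e i)` is a normalized unconditional basic sequence. -/
def IsNormalizedUnconditionalBasic {E : Type*} [NormedAddCommGroup E] [NormedSpace ℝ E]
    (e : ℕ → E) : Prop :=
  (∀ i, ‖e i‖ = 1) ∧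
  ∃ C : ℝ, ∀ S F : Finset ℕ, S ⊆ F → ∀ a : ℕ → ℝ,
    ‖∑ i ∈ S, a i • e i‖ ≤ C * ‖∑ i ∈ F, a i • e i‖

/-- `(x i)` dominates `(y i)`. -/
def Dominates {X Y : Type*} [NormedAddCommGroup X] [NormedSpace ℝ X]
    [NormedAddCommGroup Y] [NormedSpace ℝ Y] (x : ℕ → X) (y : ℕ → Y) : Prop :=
  ∃ C : ℝ, ∀ (s : Finset ℕ) (a : ℕ → ℝ),
    ‖∑ i ∈ s, a i • y i‖ ≤ C * ‖∑ i ∈ s, a i • x i‖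

/-- Two sequences are equivalent if each dominates the other. -/
def EquivalentSeq {X Y : Type*} [NormedAddCommGroup X] [NormedSpace ℝ X]
    [NormedAddCommGroup Y] [NormedSpace ℝ Y] (x : ℕ → X) (y : ℕ → Y) : Prop :=
  Dominates x y ∧ Dominates y x

/-- `(v n)` is a block basis of `(e i)`. -/
def IsBlockBasis {E : Type*} [NormedAddCommGroup E] [NormedSpace ℝ E]
    (e v : ℕ → E) : Prop :=
  ∃ q : ℕ → ℕ, StrictMono q ∧ ∃ a : ℕ → ℝ,
    ∀ n, v n ≠ 0 ∧ v n = ∑ i ∈ Finset.Ico (q n) (q (n + 1)), a i • e i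

/-- A sequence is semi-normalized. -/
def SemiNormalized {E : Type*} [NormedAddCommGroup E] (x : ℕ → E) : Prop :=
  ∃ c C : ℝ, 0 < c ∧ ∀ i, c ≤ ‖x i‖ ∧ ‖x i‖ ≤ C

/-- `(e i)` is right dominant. -/
def RightDominantBound {E : Type*} [NormedAddCommGroup E] [NormedSpace ℝ E]
    (e : ℕ → E) : Prop :=
  ∃ C : ℝ, ∀ m n : ℕ → ℕ, (∀ i, m i ≤ n i) → (∀ i, n i < m (i + 1)) →
    ∀ (s : Finset ℕ) (a : ℕ → ℝ),
      ‖∑ i ∈ s, a i • e (m i)‖ ≤ C * ‖∑ i ∈ s, a i • e (n i)‖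

/-- The James norm associated to `(e i)` of a (finitely supported) scalar sequence. -/
def jamesNorm {E : Type*} [NormedAddCommGroup E] [NormedSpace ℝ E]
    (e : ℕ → E) (a : ℕ → ℝ) : ℝ :=
  sSup { x : ℝ | ∃ (k : ℕ) (p : ℕ → ℕ), 0 < k ∧ p 0 = 0 ∧ StrictMono p ∧
    x = ‖∑ i ∈ Finset.range k, (∑ j ∈ Finset.Ico (p i) (p (i + 1)), a j) • e (p i)‖ }

/-- `X`, together with the sequence `(u i)`, is the James-type space over `(e i)`. -/
def IsJamesSpace {E X : Type*} [NormedAddCommGroup E] [NormedSpace ℝ E]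
    [NormedAddCommGroup X] [NormedSpace ℝ X] (e : ℕ → E) (u : ℕ → X) : Prop :=
  Dense (Submodule.span ℝ (Set.range u) : Set X) ∧
  ∀ a : ℕ →₀ ℝ, ‖∑ i ∈ a.support, a i • u i‖ = jamesNorm e (a : ℕ → ℝ)

/-- `(e i)` is shrinking: the span of the biorthogonal functionals is dense in the dual of
the closed linear span of `(e i)`. -/
def IsShrinking {E : Type*} [NormedAddCommGroup E] [NormedSpace ℝ E] (e : ℕ → E) : Prop :=
  ∃ e' : ℕ → ((Submodule.span ℝ (Set.range e)).topologicalClosure →L[ℝ] ℝ),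
    (∀ i j, e' i ⟨e j, Submodule.le_topologicalClosure _
        (Submodule.subset_span (Set.mem_range_self j))⟩ = if i = j then 1 else 0) ∧
    Dense (Submodule.span ℝ (Set.range e') :
      Set ((Submodule.span ℝ (Set.range e)).topologicalClosure →L[ℝ] ℝ))

/-- `E` satisfies an upper `p`-estimate with respect to the unconditional basis `(e i)`. -/
def UpperPEstimate {E : Type*} [NormedAddCommGroup E] [NormedSpace ℝ E]
    (e : ℕ → E) (p : ℝ) : Prop :=
  ∃ C : ℝ, ∀ (n : ℕ) (x : ℕ → E) (s : ℕ → Finset ℕ) (a : ℕ → ℕ → ℝ),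
    (∀ k, k < n → x k = ∑ i ∈ s k, a k i • e i) →
    (∀ k l, k < n → l < n → k ≠ l → Disjoint (s k) (s l)) →
    ‖∑ k ∈ Finset.range n, x k‖ ≤ C * (∑ k ∈ Finset.range n, ‖x k‖ ^ p) ^ (1 / p)

/-- `(e i)` is subsymmetric: unconditional and equivalent to all of its subsequences. -/
def IsSubsymmetric {E : Type*} [NormedAddCommGroup E] [NormedSpace ℝ E] (e : ℕ → E) : Prop :=
  (∃ C : ℝ, ∀ S F : Finset ℕ, S ⊆ F → ∀ a : ℕ → ℝ,
    ‖∑ i ∈ S, a i • e i‖ ≤ C * ‖∑ i ∈ F, a i • e i‖) ∧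
  ∀ φ : ℕ → ℕ, StrictMono φ → EquivalentSeq e (e ∘ φ)

/-- `(e i)` is a symmetric basic sequence: equivalent to all of its permutations. -/
def IsSymmetricSeq {E : Type*} [NormedAddCommGroup E] [NormedSpace ℝ E] (e : ℕ → E) : Prop :=
  ∀ σ : Equiv.Perm ℕ, EquivalentSeq e (fun i => e (σ i))

/-- A topological space is scattered if every nonempty closed subset has a point isolated
in that subset. -/
def Scattered (K : Type*) [TopologicalSpace K] : Prop :=
  ∀ C : Set K, C.Nonempty → IsClosed C → ∃ x ∈ C, ∃ U : Set K, IsOpen U ∧ U ∩ C = {x}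

end


/-! ### A general package for bases -/

theorem basis_package {V : Type*} [NormedAddCommGroup V] [NormedSpace ℝ V]
    (v : ℕ → V) (hd : Dense (Submodule.span ℝ (Set.range v) : Set V))
    (h1 : ∀ i, 1 ≤ ‖v i‖) (C : ℝ) (hC0 : 0 ≤ C)
    (hC : ∀ (n : ℕ) (a : ℕ →₀ ℝ),
      ‖∑ i ∈ Finset.range n, a i • v i‖ ≤ C * ‖Finsupp.linearCombination ℝ v a‖) :
    ∃ vs : ℕ → (V →L[ℝ] ℝ), (∀ i a, vs i (Finsupp.linearCombination ℝ v a) = a i) ∧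
      (∀ n x, ‖∑ i ∈ Finset.range n, vs i x • v i‖ ≤ C * ‖x‖) ∧
      (∀ x, Tendsto (fun n => ∑ i ∈ Finset.range n, vs i x • v i) atTop (𝓝 x)) := by
  have hdr : DenseRange (Finsupp.linearCombination ℝ v) := by
    have : Set.range (Finsupp.linearCombination ℝ v) = (Submodule.span ℝ (Set.range v) : Set V) := by
      rw [← Finsupp.range_linearCombination]; rfl
    rw [DenseRange, this]; exact hd
  have hb : ∀ i (a : ℕ →₀ ℝ), ‖Finsupp.lapply (R := ℝ) i a‖ ≤
      (2 * C) * ‖Finsupp.linearCombination ℝ v a‖ := by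
    intro i a
    have e1 : a i • v i = ∑ j ∈ Finset.range (i+1), a j • v j - ∑ j ∈ Finset.range i, a j • v j := by
      rw [Finset.sum_range_succ]; abel
    have e2 : ‖a i • v i‖ ≤ (2 * C) * ‖Finsupp.linearCombination ℝ v a‖ := by
      rw [e1]
      refine (norm_sub_le _ _).trans ?_
      linarith [hC (i+1) a, hC i a]
    rw [norm_smul] at e2
    have := mul_le_mul_of_nonneg_left (h1 i) (norm_nonneg (a i))
    simp only [Finsupp.lapply_apply]
    linarith
  refine ⟨fun i => (Finsupp.lapply (R := ℝ) i).extendOfNorm (Finsupp.linearCombination ℝ v), ?_⟩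
  have key : ∀ i a, ((Finsupp.lapply (R := ℝ) i).extendOfNorm (Finsupp.linearCombination ℝ v))
      (Finsupp.linearCombination ℝ v a) = a i := by
    intro i a
    exact LinearMap.extendOfNorm_eq hdr ⟨_, hb i⟩ a
  generalize hvs : (fun i => (Finsupp.lapply (R := ℝ) (M := ℝ) i).extendOfNorm
    (Finsupp.linearCombination ℝ v)) = vs
  have key : ∀ i a, vs i (Finsupp.linearCombination ℝ v a) = a i := by
    intro i a; rw [← hvs]; exact key i a
  have bd : ∀ n x, ‖∑ i ∈ Finset.range n, vs i x • v i‖ ≤ C * ‖x‖ := by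
    intro n x
    refine hdr.induction_on (p := fun x => ‖∑ i ∈ Finset.range n, vs i x • v i‖ ≤ C * ‖x‖) x ?_ ?_
    · exact isClosed_le (by fun_prop) (by fun_prop)
    · intro a
      simp only [key]
      exact hC n a
  refine ⟨key, bd, ?_⟩
  intro x
  rw [Metric.tendsto_atTop]
  intro ε hε
  obtain ⟨a, ha⟩ := hdr.exists_dist_lt x (ε := ε / (C + 2)) (by positivity)
  rw [dist_eq_norm] at ha
  obtain ⟨N, hN⟩ : ∃ N, ∀ i ∈ a.support, i < N := by
    refine ⟨a.support.sup id + 1, fun i hi => Nat.lt_succ_of_le (Finset.le_sup (f := id) hi)⟩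
  refine ⟨N, fun n hn => ?_⟩
  set y := Finsupp.linearCombination ℝ v a with hy
  have e1 : ∑ i ∈ Finset.range n, vs i y • v i = y := by
    simp only [hy, key]
    rw [Finsupp.linearCombination_apply, Finsupp.sum]
    symm
    apply Finset.sum_subset
    · intro i hi; exact Finset.mem_range.2 ((hN i hi).trans_le hn)
    · intro i _ hi; rw [Finsupp.notMem_support_iff.1 hi, zero_smul]
  have e2 : ∑ i ∈ Finset.range n, vs i x • v i - x =
      ∑ i ∈ Finset.range n, vs i (x - y) • v i - (x - y) := by
    simp only [map_sub, sub_smul, Finset.sum_sub_distrib]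
    rw [e1]; abel
  rw [dist_eq_norm, e2]
  have h3 := norm_sub_le (∑ i ∈ Finset.range n, vs i (x - y) • v i) (x - y)
  have h4 := bd n (x - y)
  have h5 : ‖x - y‖ * (C + 2) < ε := by rwa [lt_div_iff₀ (by positivity)] at ha
  nlinarith [norm_nonneg (x - y)]

/-! ### Convex combinations in `C(K)` -/

theorem convex_small {K : Type*} [TopologicalSpace K] [CompactSpace K] [T2Space K]
    (D : Set C(K, ℝ)) (hD : Convex ℝ D) (h : ℕ → C(K, ℝ)) (hh : ∀ n, h n ∈ D) (M : ℝ)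
    (hM : ∀ n x, |h n x| ≤ M) (h0 : ∀ x, Tendsto (fun n => h n x) atTop (𝓝 0))
    (ε : ℝ) (hε : 0 < ε) : ∃ d ∈ D, ∀ x, d x < ε := by
  by_contra hcon
  push Not at hcon
  let U : Set C(K, ℝ) := {g | ∀ x, g x < ε}
  have hUo : IsOpen U := by
    have := ContinuousMap.isOpen_setOfPred_mapsTo (X := K) (Y := ℝ) isCompact_univ (isOpen_Iio (a := ε))
    convert this using 1
    ext g; simp [U, Set.MapsTo]
  have hUc : Convex ℝ U := by
    intro f hf g hg a b ha hb hab x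
    have h1 := hf x
    have h2 := hg x
    simp only [ContinuousMap.add_apply, ContinuousMap.smul_apply, smul_eq_mul]
    rcases ha.eq_or_lt with rfl | ha
    · have : b = 1 := by linarith
      subst this; simpa using h2
    · nlinarith
  have hdis : Disjoint U D := by
    rw [Set.disjoint_left]
    intro g hg hgD
    obtain ⟨x, hx⟩ := hcon g hgD
    exact absurd (hg x) (not_lt.2 hx)
  obtain ⟨Φ, s, hΦU, hΦD⟩ := geometric_hahn_banach_open hUc hUo hD hdis
  have hs : 0 < s := by
    have := hΦU 0 (fun x => by simpa using hε)
    simpa using this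
  have hpos : ∀ g : C(K, ℝ), (∀ x, 0 ≤ g x) → 0 ≤ Φ g := by
    intro g hg
    by_contra hneg
    push Not at hneg
    have := hΦU ((s / Φ g) • g) (fun x => by
      simp only [ContinuousMap.smul_apply, smul_eq_mul]
      have : s / Φ g ≤ 0 := div_nonpos_of_nonneg_of_nonpos hs.le hneg.le
      nlinarith [hg x])
    rw [map_smul, smul_eq_mul, div_mul_cancel₀ _ hneg.ne] at this
    exact lt_irrefl _ this
  let _ : MeasurableSpace K := borel K
  have : BorelSpace K := ⟨rfl⟩
  let Λ : CompactlySupportedContinuousMap K ℝ →ₚ[ℝ] ℝ :=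
  { toFun g := Φ g.toContinuousMap
    map_add' g g' := by
      rw [← map_add]; rfl
    map_smul' c g := by
      rw [RingHom.id_apply, ← map_smul]; rfl
    monotone' g g' hgg' := by
      have := hpos (g'.toContinuousMap - g.toContinuousMap) (fun x => sub_nonneg.2 (hgg' x))
      rw [map_sub] at this
      exact sub_nonneg.1 this }
  have hint : ∀ g : C(K, ℝ), ∫ x, g x ∂(RealRMK.rieszMeasure Λ) = Φ g := by
    intro g
    exact RealRMK.integral_rieszMeasure Λ ⟨g, HasCompactSupport.of_compactSpace _⟩
  have hlim : Tendsto (fun n => ∫ x, h n x ∂(RealRMK.rieszMeasure Λ)) atTop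
      (𝓝 (∫ x, (0 : ℝ) ∂(RealRMK.rieszMeasure Λ))) := by
    apply MeasureTheory.tendsto_integral_of_dominated_convergence (fun _ => M)
    · intro n
      exact (h n).continuous.aestronglyMeasurable
    · exact MeasureTheory.integrable_const _
    · intro n
      exact Eventually.of_forall (fun x => hM n x)
    · exact Eventually.of_forall h0
  simp only [hint, MeasureTheory.integral_zero] at hlim
  exact absurd (ge_of_tendsto' hlim (fun n => hΦD _ (hh n))) (not_le.2 hs)

/-! ### The greatest element of `P` below `j` -/

open Classical in
/-- The greatest element of `P ∪ {0}` not exceeding the argument. -/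
noncomputable def rr (P : Set ℕ) : ℕ → ℕ
  | 0 => 0
  | j + 1 => if j + 1 ∈ P then j + 1 else rr P j

theorem rr_le (P : Set ℕ) (j : ℕ) : rr P j ≤ j := by
  induction j with
  | zero => simp [rr]
  | succ j ih =>
    rw [rr]; split_ifs
    · exact le_rfl
    · omega

theorem rr_ge {P : Set ℕ} {q j : ℕ} (hq : q ∈ P) (hj : q ≤ j) : q ≤ rr P j := by
  induction j with
  | zero => omega
  | succ j ih =>
    rw [rr]; split_ifs with h
    · exact hj
    · rcases Nat.lt_or_ge j q with h1 | h1
      · have : q = j + 1 := by omega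
        exact absurd (this ▸ hq) h
      · exact ih h1

theorem rr_mem (P : Set ℕ) (j : ℕ) : rr P j = 0 ∨ rr P j ∈ P := by
  induction j with
  | zero => simp [rr]
  | succ j ih =>
    rw [rr]; split_ifs with h
    · exact Or.inr h
    · exact ih

theorem rr_eq {P : Set ℕ} {i j : ℕ} (hi : i ∈ P ∨ i = 0) (hij : i ≤ j)
    (h : ∀ l, i < l → l ≤ j → l ∉ P) : rr P j = i := by
  have h1 : i ≤ rr P j := by
    rcases hi with hi | rfl
    · exact rr_ge hi hij
    · exact Nat.zero_le _
  by_contra hne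
  have h2 : i < rr P j := lt_of_le_of_ne h1 (Ne.symm hne)
  rcases rr_mem P j with h3 | h3
  · omega
  · exact h _ h2 (rr_le P j) h3

theorem rr_not_mem {P : Set ℕ} {j l : ℕ} (h1 : rr P j < l) (h2 : l ≤ j) : l ∉ P := fun h =>
  absurd (rr_ge h h2) (not_le.2 h1)

theorem rr_congr {P P' : Set ℕ} {j : ℕ} (h : ∀ i, 0 < i → i ≤ j → (i ∈ P ↔ i ∈ P')) :
    rr P j = rr P' j := by
  symm
  apply rr_eq
  · rcases rr_mem P j with h1 | h1
    · exact Or.inr h1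
    · rcases Nat.eq_zero_or_pos (rr P j) with h2 | h2
      · exact Or.inr h2
      · exact Or.inl ((h _ h2 (rr_le P j)).1 h1)
  · exact rr_le P j
  · intro l hl hlj hl'
    exact rr_not_mem hl hlj ((h l (by omega) hlj).2 hl')

theorem rr_congr_of_mem {P P' : Set ℕ} {q j : ℕ} (hq : q ∈ P) (hq' : q ∈ P') (hqj : q ≤ j)
    (h : ∀ i, q < i → i ≤ j → (i ∈ P ↔ i ∈ P')) :
    rr P j = rr P' j := by
  symm
  have h0 := rr_ge hq hqj
  apply rr_eq
  · rcases h0.eq_or_lt with h1 | h1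
    · rw [← h1]; exact Or.inl hq'
    · left
      refine (h _ h1 (rr_le P j)).1 ?_
      rcases rr_mem P j with h2 | h2
      · omega
      · exact h2
  · exact rr_le P j
  · intro l hl hlj hl'
    exact rr_not_mem hl hlj ((h l (by omega) hlj).2 hl')

theorem rr_mono (P : Set ℕ) : Monotone (rr P) := by
  apply monotone_nat_of_le_succ
  intro n
  conv_rhs => rw [rr]
  split_ifs
  · exact (rr_le P n).trans (Nat.le_succ n)
  · exact le_rfl


/-- The vector obtained from `a` through the partition given by `P`. -/
noncomputable def TT {E : Type*} [NormedAddCommGroup E] [NormedSpace ℝ E] (e : ℕ → E)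
    (P : Set ℕ) : (ℕ →₀ ℝ) →ₗ[ℝ] E :=
  Finsupp.linearCombination ℝ (fun j => e (rr P j))

/-- Basis projections. -/
noncomputable def QQ {E : Type*} [NormedAddCommGroup E] [NormedSpace ℝ E] (e : ℕ → E)
    (es : ℕ → (E →L[ℝ] ℝ)) (n : ℕ) : E →L[ℝ] E :=
  ∑ i ∈ Finset.range n, (es i).smulRight (e i)

/-- Finitely supported sequence built from a function. -/
noncomputable def tr (s : Finset ℕ) (c : ℕ → ℝ) : ℕ →₀ ℝ := ∑ j ∈ s, Finsupp.single j (c j)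

section
variable {E : Type*} [NormedAddCommGroup E] [NormedSpace ℝ E]

theorem lc_tr (v : ℕ → E) (s : Finset ℕ) (c : ℕ → ℝ) :
    Finsupp.linearCombination ℝ v (tr s c) = ∑ j ∈ s, c j • v j := by
  simp [tr, map_sum, Finsupp.linearCombination_single]

theorem TT_tr (e : ℕ → E) (P : Set ℕ) (s : Finset ℕ) (c : ℕ → ℝ) :
    TT e P (tr s c) = ∑ j ∈ s, c j • e (rr P j) := lc_tr _ s c

theorem tr_apply (s : Finset ℕ) (c : ℕ → ℝ) (i : ℕ) : tr s c i = if i ∈ s then c i else 0 := by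
  rw [tr, Finsupp.finsetSum_apply]
  simp only [Finsupp.single_apply]
  rw [Finset.sum_ite_eq']

theorem lc_range (v : ℕ → E) (a : ℕ →₀ ℝ) (n : ℕ) : ∃ N, n ≤ N ∧
    Finsupp.linearCombination ℝ v a = ∑ j ∈ Finset.range N, a j • v j := by
  refine ⟨max n (a.support.sup id + 1), le_max_left _ _, ?_⟩
  rw [Finsupp.linearCombination_apply, Finsupp.sum]
  apply Finset.sum_subset
  · intro i hi
    rw [Finset.mem_range]
    exact lt_max_of_lt_right (Nat.lt_succ_of_le (Finset.le_sup (f := id) hi))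
  · intro i _ hi; rw [Finsupp.notMem_support_iff.1 hi, zero_smul]

variable {e : ℕ → E} {es : ℕ → (E →L[ℝ] ℝ)}

theorem QQ_apply (n : ℕ) (x : E) : QQ e es n x = ∑ i ∈ Finset.range n, es i x • e i := by
  simp [QQ]

theorem QQ_e (hes : ∀ i j, es i (e j) = if i = j then 1 else 0) (n j : ℕ) :
    QQ e es n (e j) = if j < n then e j else 0 := by
  rw [QQ_apply]
  simp only [hes, ite_smul, one_smul, zero_smul, Finset.sum_ite_eq', Finset.mem_range]

theorem QQ_sum_low (hes : ∀ i j, es i (e j) = if i = j then 1 else 0) (P : Set ℕ) (n : ℕ)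
    (s : Finset ℕ) (hs : ∀ j ∈ s, j < n) (c : ℕ → ℝ) :
    QQ e es n (∑ j ∈ s, c j • e (rr P j)) = ∑ j ∈ s, c j • e (rr P j) := by
  rw [map_sum]
  apply Finset.sum_congr rfl
  intro j hj
  rw [map_smul, QQ_e hes, if_pos ((rr_le P j).trans_lt (hs j hj))]

theorem QQ_sum_high (hes : ∀ i j, es i (e j) = if i = j then 1 else 0) (P : Set ℕ) (n : ℕ)
    (hn : n ∈ P) (s : Finset ℕ) (hs : ∀ j ∈ s, n ≤ j) (c : ℕ → ℝ) :
    QQ e es n (∑ j ∈ s, c j • e (rr P j)) = 0 := by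
  rw [map_sum]
  apply Finset.sum_eq_zero
  intro j hj
  rw [map_smul, QQ_e hes, if_neg (not_lt.2 (rr_ge hn (hs j hj))), smul_zero]

theorem QQ_TT (hes : ∀ i j, es i (e j) = if i = j then 1 else 0) (P : Set ℕ) (n : ℕ) (hn : n ∈ P)
    (a : ℕ →₀ ℝ) : QQ e es n (TT e P a) = ∑ j ∈ Finset.range n, a j • e (rr P j) := by
  obtain ⟨N, hnN, hN⟩ := lc_range (fun j => e (rr P j)) a n
  rw [TT, hN, ← Finset.sum_range_add_sum_Ico _ hnN, map_add,
    QQ_sum_low hes P n _ (fun j hj => Finset.mem_range.1 hj),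
    QQ_sum_high hes P n hn _ (fun j hj => (Finset.mem_Ico.1 hj).1), add_zero]

theorem partition_sum (e : ℕ → E) (a : ℕ → ℝ) (p : ℕ → ℕ) (hp : StrictMono p) (h0 : p 0 = 0)
    (k : ℕ) :
    ∑ i ∈ Finset.range k, (∑ j ∈ Finset.Ico (p i) (p (i + 1)), a j) • e (p i) =
      ∑ j ∈ Finset.range (p k), a j • e (rr (Set.range p) j) := by
  induction k with
  | zero => simp [h0]
  | succ k ih =>
    rw [Finset.sum_range_succ, ih, ← Finset.sum_range_add_sum_Ico _ (hp (Nat.lt_succ_self k)).le,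
      Finset.sum_smul]
    congr 1
    apply Finset.sum_congr rfl
    intro j hj
    rw [Finset.mem_Ico] at hj
    rw [rr_eq (i := p k) (Or.inl (Set.mem_range_self k)) hj.1]
    rintro l hl hlj ⟨m, rfl⟩
    have h1 := hp.lt_iff_lt.1 hl
    have h2 := hp.lt_iff_lt.1 (hlj.trans_lt hj.2)
    omega

theorem james_bdd (e : ℕ → E) (h1 : ∀ i, ‖e i‖ = 1) (a : ℕ →₀ ℝ) :
    BddAbove { x : ℝ | ∃ (k : ℕ) (p : ℕ → ℕ), 0 < k ∧ p 0 = 0 ∧ StrictMono p ∧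
    x = ‖∑ i ∈ Finset.range k, (∑ j ∈ Finset.Ico (p i) (p (i + 1)), a j) • e (p i)‖ } := by
  refine ⟨∑ j ∈ a.support, |a j|, ?_⟩
  rintro x ⟨k, p, -, h0, hp, rfl⟩
  rw [partition_sum e a p hp h0]
  refine (norm_sum_le _ _).trans ?_
  simp only [norm_smul, h1, mul_one, Real.norm_eq_abs]
  rw [← Finset.sum_filter_add_sum_filter_not (Finset.range (p k)) (fun j => a j ≠ 0)]
  have : ∑ j ∈ Finset.range (p k) with ¬ a j ≠ 0, |a j| = 0 := by
    apply Finset.sum_eq_zero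
    intro j hj
    have := (Finset.mem_filter.1 hj).2
    push Not at this
    simp [this]
  rw [this, add_zero]
  apply Finset.sum_le_sum_of_subset_of_nonneg
  · intro j hj
    exact Finsupp.mem_support_iff.2 (Finset.mem_filter.1 hj).2
  · intros; exact abs_nonneg _

variable {X : Type*} [NormedAddCommGroup X] [NormedSpace ℝ X] {u : ℕ → X}

theorem james_upper (h1 : ∀ i, ‖e i‖ = 1) (hJ : IsJamesSpace e u) (P : Set ℕ) (a : ℕ →₀ ℝ) :
    ‖TT e P a‖ ≤ ‖Finsupp.linearCombination ℝ u a‖ := by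
  classical
  have hn : ‖Finsupp.linearCombination ℝ u a‖ = jamesNorm e (a : ℕ → ℝ) := hJ.2 a
  rw [hn]
  obtain ⟨N, hN1, hN⟩ := lc_range (fun j => e (rr P j)) a 1
  rw [TT, hN]
  let P' : ℕ → Prop := fun i => i = 0 ∨ i ∈ P ∨ N ≤ i
  have hinf : (Set.ofPred P').Infinite := by
    apply Set.Infinite.mono (s := Set.Ici N) _ (Set.Ici_infinite N)
    intro i hi
    exact Or.inr (Or.inr hi)
  have hrange : Set.range (Nat.nth P') = Set.ofPred P' := Nat.range_nth_of_infinite hinf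
  have hp0 : Nat.nth P' 0 = 0 := Nat.nth_zero_of_zero (Or.inl rfl)
  have hcN : Nat.nth P' (Nat.count P' N) = N := Nat.nth_count (Or.inr (Or.inr le_rfl))
  have hmono : StrictMono (Nat.nth P') := Nat.nth_strictMono hinf
  apply le_csSup (james_bdd e h1 a)
  refine ⟨Nat.count P' N, Nat.nth P', ?_, hp0, hmono, ?_⟩
  · rcases Nat.eq_zero_or_pos (Nat.count P' N) with h | h
    · rw [h, hp0] at hcN; omega
    · exact h
  · rw [partition_sum e a _ hmono hp0, hcN, hrange]
    congr 1
    apply Finset.sum_congr rfl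
    intro j hj
    rw [Finset.mem_range] at hj
    congr 2
    apply rr_congr
    intro i hi hij
    show i ∈ P ↔ (i = 0 ∨ i ∈ P ∨ N ≤ i)
    constructor
    · intro h; exact Or.inr (Or.inl h)
    · rintro (h | h | h)
      · omega
      · exact h
      · omega

theorem james_lower (hJ : IsJamesSpace e u)
    (hes : ∀ i j, es i (e j) = if i = j then 1 else 0) {C : ℝ} (hC0 : 0 ≤ C)
    (hC : ∀ n x, ‖QQ e es n x‖ ≤ C * ‖x‖) (a : ℕ →₀ ℝ) (B : ℝ)
    (hB : ∀ P, ‖TT e P a‖ ≤ B) :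
    ‖Finsupp.linearCombination ℝ u a‖ ≤ C * B := by
  have hn : ‖Finsupp.linearCombination ℝ u a‖ = jamesNorm e (a : ℕ → ℝ) := hJ.2 a
  rw [hn]
  apply csSup_le
  · exact ⟨_, 1, id, one_pos, rfl, strictMono_id, rfl⟩
  rintro x ⟨k, p, hk, h0, hp, rfl⟩
  rw [partition_sum e a p hp h0, ← QQ_TT hes (Set.range p) (p k) ⟨k, rfl⟩]
  exact (hC _ _).trans (mul_le_mul_of_nonneg_left (hB _) hC0)

theorem james_proj (h1 : ∀ i, ‖e i‖ = 1) (hJ : IsJamesSpace e u)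
    (hes : ∀ i j, es i (e j) = if i = j then 1 else 0) {C : ℝ} (hC0 : 0 ≤ C)
    (hC : ∀ n x, ‖QQ e es n x‖ ≤ C * ‖x‖) (n : ℕ) (a : ℕ →₀ ℝ) :
    ‖∑ i ∈ Finset.range n, a i • u i‖ ≤ C * C * ‖Finsupp.linearCombination ℝ u a‖ := by
  rw [← lc_tr, mul_assoc]
  apply james_lower hJ hes hC0 hC
  intro P
  rw [TT_tr]
  have : ∑ j ∈ Finset.range n, a j • e (rr P j) = QQ e es n (TT e (insert n P) a) := by
    rw [QQ_TT hes _ n (Set.mem_insert _ _)]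
    apply Finset.sum_congr rfl
    intro j hj
    rw [Finset.mem_range] at hj
    congr 2
    apply rr_congr
    intro i _ hi
    rw [Set.mem_insert_iff]
    constructor
    · intro h; exact Or.inr h
    · rintro (h | h)
      · omega
      · exact h
  rw [this]
  exact (hC _ _).trans (mul_le_mul_of_nonneg_left (james_upper h1 hJ _ a) hC0)

/-- weak cluster points in a reflexive space -/
theorem reflexive_cluster (hrefl : IsReflexiveSpace E) {ι : Type*} (x : ι → E) (M : ℝ)
    (hM : ∀ n, ‖x n‖ ≤ M) (F : Ultrafilter ι) :
    ∃ x₀ : E, ∀ g : E →L[ℝ] ℝ, Tendsto (fun n => g (x n)) F (𝓝 (g x₀)) := by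
  have hc := WeakDual.isCompact_closedBall (𝕜 := ℝ) (E := E →L[ℝ] ℝ) 0 M
  let xx : ι → WeakDual ℝ (E →L[ℝ] ℝ) := fun n =>
    StrongDual.toWeakDual (NormedSpace.inclusionInDoubleDual ℝ E (x n))
  have hmem : ∀ n, xx n ∈ (WeakDual.toStrongDual ⁻¹'
      Metric.closedBall (0 : StrongDual ℝ (E →L[ℝ] ℝ)) M) := by
    intro n
    have h : NormedSpace.inclusionInDoubleDual ℝ E (x n) ∈
        Metric.closedBall (0 : StrongDual ℝ (E →L[ℝ] ℝ)) M := by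
      refine (mem_closedBall_zero_iff (E := StrongDual ℝ (E →L[ℝ] ℝ))).2 ?_
      exact (NormedSpace.double_dual_bound ℝ E (x n)).trans (hM n)
    exact h
  obtain ⟨ξ, -, hξ⟩ := hc.ultrafilter_le_nhds (F.map xx) (by
    rw [le_principal_iff]
    exact Filter.mem_map.2 (Eventually.of_forall hmem))
  obtain ⟨x₀, hx₀⟩ := hrefl (WeakDual.toStrongDual ξ)
  refine ⟨x₀, fun g => ?_⟩
  have h1 : Tendsto (fun n => xx n g) F (𝓝 (ξ g)) :=
    ((WeakDual.eval_continuous g).tendsto ξ).comp hξ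
  have h2 : ξ g = g x₀ := by
    have : (NormedSpace.inclusionInDoubleDual ℝ E x₀) g = (WeakDual.toStrongDual ξ) g := by rw [hx₀]
    rw [NormedSpace.dual_def] at this
    exact this.symm
  rw [h2] at h1
  exact h1

theorem weak_null (hrefl : IsReflexiveSpace E)
    (hconv : ∀ x, Tendsto (fun n => ∑ i ∈ Finset.range n, es i x • e i) atTop (𝓝 x))
    (x : ℕ → E) (M : ℝ) (hM : ∀ n, ‖x n‖ ≤ M)
    (h0 : ∀ i, Tendsto (fun n => es i (x n)) atTop (𝓝 0)) (g : E →L[ℝ] ℝ) :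
    Tendsto (fun n => g (x n)) atTop (𝓝 0) := by
  rw [tendsto_iff_ultrafilter]
  intro F hF
  obtain ⟨x₀, hx₀⟩ := reflexive_cluster hrefl x M hM F
  have hz : ∀ i, es i x₀ = 0 := fun i => tendsto_nhds_unique (hx₀ (es i)) ((h0 i).mono_left hF)
  have : x₀ = 0 := by
    have h := hconv x₀
    simp only [hz, zero_smul, Finset.sum_const_zero] at h
    exact (tendsto_nhds_unique h tendsto_const_nhds)
  have h := hx₀ g
  rw [this, map_zero] at h
  exact h

end


section
variable {E : Type*} [NormedAddCommGroup E] [NormedSpace ℝ E]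
variable {e : ℕ → E} {es : ℕ → (E →L[ℝ] ℝ)}

theorem es_bound (h1 : ∀ i, ‖e i‖ = 1) {C : ℝ}
    (hC : ∀ n x, ‖QQ e es n x‖ ≤ C * ‖x‖) (i : ℕ) (x : E) : |es i x| ≤ 2 * C * ‖x‖ := by
  have h : es i x • e i = QQ e es (i+1) x - QQ e es i x := by
    rw [QQ_apply, QQ_apply, Finset.sum_range_succ]; abel
  have h2 : ‖es i x • e i‖ = |es i x| := by rw [norm_smul, h1, mul_one, Real.norm_eq_abs]
  rw [← h2, h]
  refine (norm_sub_le _ _).trans ?_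
  linarith [hC (i+1) x, hC i x]

theorem tail_insert (h1 : ∀ i, ‖e i‖ = 1) (hes : ∀ i j, es i (e j) = if i = j then 1 else 0)
    {C : ℝ} (hC : ∀ n x, ‖QQ e es n x‖ ≤ C * ‖x‖) (P : Set ℕ) (q : ℕ) (s : Finset ℕ)
    (hs : ∀ j ∈ s, q ≤ j) (c : ℕ → ℝ) :
    ‖∑ j ∈ s, c j • e (rr P j)‖ ≤ (1 + 3 * C) * ‖∑ j ∈ s, c j • e (rr (insert q P) j)‖ := by
  let L : E →L[ℝ] E := ContinuousLinearMap.id ℝ E - QQ e es (q + 1) + (es q).smulRight (e (rr P q))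
  have hL : ∀ x, L x = x - QQ e es (q+1) x + es q x • e (rr P q) := fun x => rfl
  have hLe : ∀ j, q ≤ j → L (e (rr (insert q P) j)) = e (rr P j) := by
    intro j hj
    rw [hL, QQ_e hes, hes]
    have hge : q ≤ rr (insert q P) j := rr_ge (Set.mem_insert _ _) hj
    rcases hge.eq_or_lt with h | h
    · rw [← h, if_pos (Nat.lt_succ_self q), if_pos rfl, sub_self, zero_add, one_smul]
      congr 1
      symm
      apply rr_eq
      · exact (rr_mem P q).symm
      · exact (rr_le P q).trans hj
      · intro l hl hlj hlP
        rcases Nat.lt_or_ge q l with h3 | h3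
        · exact rr_not_mem (h ▸ h3) hlj (Set.mem_insert_of_mem _ hlP)
        · exact rr_not_mem hl h3 hlP
    · rw [if_neg (by omega), if_neg (by omega), sub_zero, zero_smul, add_zero]
      congr 1
      symm
      apply rr_eq
      · rcases rr_mem (insert q P) j with h3 | h3
        · exact Or.inr h3
        · rcases h3 with h3 | h3
          · omega
          · exact Or.inl h3
      · exact rr_le _ _
      · intro l hl hlj hlP
        exact rr_not_mem hl hlj (Set.mem_insert_of_mem _ hlP)
  have hsum : ∑ j ∈ s, c j • e (rr P j) = L (∑ j ∈ s, c j • e (rr (insert q P) j)) := by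
    rw [map_sum]
    apply Finset.sum_congr rfl
    intro j hj
    rw [map_smul, hLe j (hs j hj)]
  rw [hsum]
  generalize (∑ j ∈ s, c j • e (rr (insert q P) j)) = x
  rw [hL]
  have a1 := norm_add_le (x - QQ e es (q+1) x) (es q x • e (rr P q))
  have a2 := norm_sub_le x (QQ e es (q+1) x)
  have a3 := hC (q+1) x
  have a4 := es_bound h1 hC q x
  rw [norm_smul, h1, mul_one, Real.norm_eq_abs] at a1
  linarith

variable {X : Type*} [NormedAddCommGroup X] [NormedSpace ℝ X] {u : ℕ → X}

theorem bounded_complete (hrefl : IsReflexiveSpace E) (h1 : ∀ i, ‖e i‖ = 1)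
    (hJ : IsJamesSpace e u)
    (hes : ∀ i j, es i (e j) = if i = j then 1 else 0) {C : ℝ} (hC0 : 0 ≤ C)
    (hC : ∀ n x, ‖QQ e es n x‖ ≤ C * ‖x‖) (hconv : ∀ x, Tendsto (fun n => QQ e es n x) atTop (𝓝 x))
    (c : ℕ → ℝ) (M : ℝ) (hM : ∀ n, ‖∑ j ∈ Finset.range n, c j • u j‖ ≤ M) :
    CauchySeq (fun n => ∑ j ∈ Finset.range n, c j • u j) := by
  by_contra hcon
  have hstep : ∃ ε > 0, ∀ N, ∃ q r, N ≤ q ∧ q < r ∧ ε ≤ ‖∑ j ∈ Finset.Ico q r, c j • u j‖ := by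
    rw [Metric.cauchySeq_iff'] at hcon
    push Not at hcon
    obtain ⟨ε, hε, h⟩ := hcon
    refine ⟨ε, hε, fun N => ?_⟩
    obtain ⟨n, hn, hd⟩ := h N
    have hne : N ≠ n := by
      rintro rfl
      rw [dist_self] at hd; linarith
    refine ⟨N, n, le_rfl, lt_of_le_of_ne hn hne, ?_⟩
    rw [dist_eq_norm, ← Finset.sum_range_add_sum_Ico _ hn, add_sub_cancel_left] at hd
    exact hd
  obtain ⟨ε, hε, hstep⟩ := hstep
  set D : ℝ := 1 + 3 * C with hD
  have hD0 : 0 ≤ D := by positivity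
  set ε' : ℝ := ε / (C * D + 1) with hε'
  have hε'0 : 0 < ε' := by positivity
  have hε'1 : C * (D * ε') < ε := by
    have : ε' * (C * D + 1) = ε := by rw [hε']; field_simp
    nlinarith
  have hstep2 : ∀ N, ∃ q r, ∃ P : Set ℕ, N ≤ q ∧ q < r ∧ q ∈ P ∧
      ε' < ‖∑ j ∈ Finset.Ico q r, c j • e (rr P j)‖ := by
    intro N
    obtain ⟨q, r, hNq, hqr, hn⟩ := hstep N
    by_contra hall
    push Not at hall
    have h2 : ∀ P, ‖TT e P (tr (Finset.Ico q r) c)‖ ≤ D * ε' := by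
      intro P
      rw [TT_tr]
      refine (tail_insert h1 hes hC P q _ (fun j hj => (Finset.mem_Ico.1 hj).1) c).trans ?_
      exact mul_le_mul_of_nonneg_left (hall q r (insert q P) hNq hqr (Set.mem_insert _ _)) hD0
    have h3 := james_lower hJ hes hC0 hC _ _ h2
    rw [lc_tr] at h3
    linarith
  choose q r P hNq hqr hqP hbig using hstep2
  let NN : ℕ → ℕ := fun m => Nat.rec 0 (fun _ N => r N + 1) m
  have hNN : ∀ m, NN (m+1) = r (NN m) + 1 := fun m => rfl
  have hord : ∀ m m', m < m' → r (NN m) < q (NN m') := by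
    intro m m' h
    induction m' with
    | zero => omega
    | succ k ih =>
      have h3 : r (NN k) < q (NN (k+1)) := by
        have := hNq (NN (k+1)); rw [hNN] at this; rw [hNN]; omega
      rcases Nat.lt_succ_iff_lt_or_eq.1 h with h2 | h2
      · have := ih h2
        have := hqr (NN k)
        omega
      · rw [h2]; exact h3
  let Pc : Set ℕ := {j | ∃ m, (q (NN m) ≤ j ∧ j < r (NN m) ∧ j ∈ P (NN m)) ∨ j = r (NN m)}
  have hqPc : ∀ m, q (NN m) ∈ Pc := fun m => ⟨m, Or.inl ⟨le_rfl, hqr _, hqP _⟩⟩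
  have hrPc : ∀ m, r (NN m) ∈ Pc := fun m => ⟨m, Or.inr rfl⟩
  have hPcP : ∀ m i, q (NN m) ≤ i → i < r (NN m) → (i ∈ Pc ↔ i ∈ P (NN m)) := by
    intro m i hi1 hi2
    constructor
    · rintro ⟨m', h⟩
      have hm : m' = m := by
        rcases lt_trichotomy m' m with h3 | h3 | h3
        · have := hord _ _ h3
          have := hqr (NN m')
          rcases h with h | h <;> omega
        · exact h3
        · have := hord _ _ h3
          have := hqr (NN m')
          rcases h with h | h <;> omega
      subst hm
      rcases h with h | h
      · exact h.2.2
      · omega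
    · intro h
      exact ⟨m, Or.inl ⟨hi1, hi2, h⟩⟩
  -- the weak limit
  obtain ⟨x₀, hx₀⟩ := reflexive_cluster hrefl
    (fun n => TT e Pc (tr (Finset.range n) c)) M (fun n => by
      refine (james_upper h1 hJ _ _).trans ?_
      rw [lc_tr]; exact hM n) (hyperfilter ℕ)
  have hQ : ∀ m ∈ Pc, QQ e es m x₀ = ∑ j ∈ Finset.range m, c j • e (rr Pc j) := by
    intro m hm
    rw [SeparatingDual.eq_iff_forall_dual_eq (R := ℝ)]
    intro g
    have t1 := hx₀ (g.comp (QQ e es m))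
    refine tendsto_nhds_unique t1 ?_
    apply tendsto_const_nhds.congr'
    have hev : ∀ᶠ n in atTop, g (∑ j ∈ Finset.range m, c j • e (rr Pc j)) =
        (g.comp (QQ e es m)) (TT e Pc (tr (Finset.range n) c)) := by
      filter_upwards [eventually_ge_atTop m] with n hn
      rw [ContinuousLinearMap.comp_apply, QQ_TT hes Pc m hm]
      congr 1
      apply Finset.sum_congr rfl
      intro j hj
      rw [tr_apply, if_pos (Finset.mem_range.2 ((Finset.mem_range.1 hj).trans_le hn))]
    exact (Nat.hyperfilter_le_atTop) hev
  have hlow : ∀ m, ε' < ‖QQ e es (r (NN m)) x₀ - QQ e es (q (NN m)) x₀‖ := by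
    intro m
    rw [hQ _ (hrPc m), hQ _ (hqPc m), ← Finset.sum_range_add_sum_Ico _ (hqr (NN m)).le,
      add_sub_cancel_left]
    convert hbig (NN m) using 2
    apply Finset.sum_congr rfl
    intro j hj
    rw [Finset.mem_Ico] at hj
    congr 2
    exact rr_congr_of_mem (hqPc m) (hqP _) hj.1 (fun i hi hij =>
      hPcP m i hi.le (hij.trans_lt hj.2))
  have hqtop : Tendsto (fun m => q (NN m)) atTop atTop := by
    apply StrictMono.tendsto_atTop
    apply strictMono_nat_of_lt_succ
    intro m
    exact (hqr _).trans (hord _ _ (Nat.lt_succ_self m))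
  have hrtop : Tendsto (fun m => r (NN m)) atTop atTop :=
    tendsto_atTop_mono (fun m => (hqr _).le) hqtop
  have hl := (((hconv x₀).comp hrtop).sub ((hconv x₀).comp hqtop)).norm
  rw [sub_self, norm_zero] at hl
  exact absurd (ge_of_tendsto' hl (fun m => (hlow m).le)) (not_le.2 hε'0)

theorem fin_null (v : ℕ → ℝ) (N : ℕ) (hv : ∀ j, N ≤ j → v j = 0) (a : ℕ → (ℕ →₀ ℝ))
    (ha : ∀ j, Tendsto (fun n => a n j) atTop (𝓝 0)) :
    Tendsto (fun n => Finsupp.linearCombination ℝ v (a n)) atTop (𝓝 0) := by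
  have h : ∀ n, Finsupp.linearCombination ℝ v (a n) = ∑ j ∈ Finset.range N, a n j * v j := by
    intro n
    obtain ⟨N', hN, h⟩ := lc_range v (a n) N
    rw [h, ← Finset.sum_range_add_sum_Ico _ hN]
    have : ∑ j ∈ Finset.Ico N N', a n j • v j = 0 := by
      apply Finset.sum_eq_zero
      intro j hj
      rw [hv j (Finset.mem_Ico.1 hj).1, smul_zero]
    rw [this, add_zero]; rfl
  simp only [h]
  have := tendsto_finsetSum (Finset.range N) (fun j _ => (ha j).mul_const (v j))
  simpa using this

theorem TT_coord_null (hes : ∀ i j, es i (e j) = if i = j then 1 else 0) (P : Set ℕ) (i : ℕ)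
    (a : ℕ → (ℕ →₀ ℝ)) (ha : ∀ j, Tendsto (fun n => a n j) atTop (𝓝 0))
    (hS : Tendsto (fun n => Finsupp.linearCombination ℝ (fun _ => (1:ℝ)) (a n)) atTop (𝓝 0)) :
    Tendsto (fun n => es i (TT e P (a n))) atTop (𝓝 0) := by
  have hlc : ∀ b, es i (TT e P b) =
      Finsupp.linearCombination ℝ (fun j => if i = rr P j then (1:ℝ) else 0) b := by
    intro b
    rw [TT, Finsupp.linearCombination_apply, Finsupp.linearCombination_apply, Finsupp.sum,
      Finsupp.sum, map_sum]
    apply Finset.sum_congr rfl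
    intro j _
    rw [map_smul, hes]
  simp only [hlc]
  by_cases hA : ∃ N, ∀ j, N ≤ j → rr P j ≠ i
  · obtain ⟨N, hN⟩ := hA
    exact fin_null _ N (fun j hj => if_neg (fun h => hN j hj h.symm)) a ha
  · push Not at hA
    obtain ⟨j0, _, hj0⟩ := hA 0
    have hall : ∀ j, j0 ≤ j → rr P j = i := by
      intro j hj
      obtain ⟨j1, hj1, hj1'⟩ := hA j
      have a1 := rr_mono P hj
      have a2 := rr_mono P hj1
      omega
    have h2 := fin_null (fun j => (if i = rr P j then (1:ℝ) else 0) - 1) j0 (fun j hj => by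
      rw [if_pos (hall j hj).symm, sub_self]) a ha
    have h3 := h2.add hS
    rw [add_zero] at h3
    refine h3.congr (fun n => ?_)
    simp only [Finsupp.linearCombination_apply, Finsupp.sum]
    rw [← Finset.sum_add_distrib]
    apply Finset.sum_congr rfl
    intro j _
    simp only [smul_eq_mul]; ring

theorem rr_continuous (j : ℕ) : Continuous (fun p : ℕ → Bool => rr {n | p n = true} j) := by
  induction j with
  | zero => simp only [rr]; exact continuous_const
  | succ j ih =>
    have : (fun p : ℕ → Bool => rr {n | p n = true} (j+1)) =
        fun p => (fun x : Bool × ℕ => if x.1 = true then j + 1 else x.2)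
          (p (j+1), rr {n | p n = true} j) := by
      funext p
      simp [rr]
    rw [this]
    exact (continuous_of_discreteTopology
      (f := fun x : Bool × ℕ => if x.1 = true then j + 1 else x.2)).comp ((continuous_apply (j+1)).prodMk ih)

theorem weak_null_X (hrefl : IsReflexiveSpace E) (h1 : ∀ i, ‖e i‖ = 1)
    (hJ : IsJamesSpace e u)
    (hes : ∀ i j, es i (e j) = if i = j then 1 else 0) {C : ℝ} (hC0 : 0 ≤ C)
    (hC : ∀ n x, ‖QQ e es n x‖ ≤ C * ‖x‖) (hconv : ∀ x, Tendsto (fun n => QQ e es n x) atTop (𝓝 x))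
    (a : ℕ → (ℕ →₀ ℝ)) (M : ℝ) (hM : ∀ n, ‖Finsupp.linearCombination ℝ u (a n)‖ ≤ M)
    (ha : ∀ j, Tendsto (fun n => a n j) atTop (𝓝 0))
    (hS : Tendsto (fun n => Finsupp.linearCombination ℝ (fun _ => (1:ℝ)) (a n)) atTop (𝓝 0))
    (f : X →L[ℝ] ℝ) (δ : ℝ) (hδ : 0 < δ)
    (hf : ∀ n, δ ≤ f (Finsupp.linearCombination ℝ u (a n))) : False := by
  let B : Set (WeakDual ℝ E) := WeakDual.toStrongDual ⁻¹' Metric.closedBall (0 : StrongDual ℝ E) 1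
  have hBc : CompactSpace B := isCompact_iff_compactSpace.1 (WeakDual.isCompact_closedBall 0 1)
  let K := (ℕ → Bool) × B
  have hcont : ∀ j, Continuous (fun k : K => k.2.1 (e (rr {n | k.1 n = true} j))) := by
    intro j
    have c1 : Continuous (fun x : ℕ × WeakDual ℝ E => x.2 (e x.1)) := by
      rw [continuous_prod_of_discrete_left]
      intro i
      exact WeakDual.eval_continuous (e i)
    exact c1.comp (((rr_continuous j).comp continuous_fst).prodMk
      (continuous_subtype_val.comp continuous_snd))
  let h : (ℕ →₀ ℝ) → C(K, ℝ) := fun b =>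
    ⟨fun k => ∑ j ∈ b.support, b j * k.2.1 (e (rr {n | k.1 n = true} j)),
      continuous_finsetSum _ (fun j _ => (hcont j).const_mul _)⟩
  have hh : ∀ b (k : K), h b k = (WeakDual.toStrongDual k.2.1) (TT e {n | k.1 n = true} b) := by
    intro b k
    rw [TT, Finsupp.linearCombination_apply, Finsupp.sum, map_sum]
    apply Finset.sum_congr rfl
    intro j _
    rw [map_smul]; rfl
  have hh' : ∀ b (k : K), h b k =
      Finsupp.linearCombination ℝ (fun j => k.2.1 (e (rr {n | k.1 n = true} j))) b := by
    intro b k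
    rw [Finsupp.linearCombination_apply]; rfl
  let D : Set C(K, ℝ) := {d | ∃ b, δ ≤ f (Finsupp.linearCombination ℝ u b) ∧ ∀ k, |h b k| ≤ d k}
  have hD : Convex ℝ D := by
    rintro d ⟨b, hb1, hb2⟩ d' ⟨b', hb1', hb2'⟩ s t hs ht hst
    refine ⟨s • b + t • b', ?_, ?_⟩
    · rw [map_add, map_smul, map_smul, map_add, map_smul, map_smul, smul_eq_mul, smul_eq_mul]
      have e1 := mul_le_mul_of_nonneg_left hb1 hs
      have e2 := mul_le_mul_of_nonneg_left hb1' ht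
      have e3 : s * δ + t * δ = δ := by rw [← add_mul, hst, one_mul]
      linarith
    · intro k
      have e0 : h (s • b + t • b') k = s * h b k + t * h b' k := by
        rw [hh', hh', hh', map_add, map_smul, map_smul]; rfl
      rw [e0]
      refine (abs_add_le _ _).trans ?_
      rw [abs_mul, abs_mul, abs_of_nonneg hs, abs_of_nonneg ht]
      exact add_le_add (mul_le_mul_of_nonneg_left (hb2 k) hs)
        (mul_le_mul_of_nonneg_left (hb2' k) ht)
  have hg1 : ∀ k : K, ‖WeakDual.toStrongDual k.2.1‖ ≤ 1 := by
    intro k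
    have h : WeakDual.toStrongDual k.2.1 ∈ Metric.closedBall (0 : StrongDual ℝ E) 1 := k.2.2
    exact (mem_closedBall_zero_iff (E := StrongDual ℝ E)).1 h
  have hbd : ∀ n k, |h (a n) k| ≤ M := by
    intro n k
    rw [hh, ← Real.norm_eq_abs]
    refine (ContinuousLinearMap.le_opNorm _ _).trans ?_
    have e1 := (james_upper h1 hJ {n | k.1 n = true} (a n)).trans (hM n)
    have e2 := hg1 k
    nlinarith [norm_nonneg (TT e {n | k.1 n = true} (a n)), norm_nonneg (WeakDual.toStrongDual k.2.1)]
  have hpt : ∀ k, Tendsto (fun n => h (a n) k) atTop (𝓝 0) := by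
    intro k
    simp only [hh]
    refine weak_null (e := e) (es := es) hrefl ?_ _ M ?_ ?_ _
    · intro x; simpa only [QQ_apply] using hconv x
    · intro n; exact (james_upper h1 hJ _ _).trans (hM n)
    · intro i; exact TT_coord_null hes _ i a ha hS
  have hden : 0 < ‖f‖ * C + 1 := by positivity
  obtain ⟨d, ⟨b, hb1, hb2⟩, hd⟩ := convex_small D hD (fun n => |h (a n)|)
    (fun n => ⟨a n, hf n, fun k => by rw [ContinuousMap.abs_apply]⟩) M
    (fun n k => by rw [ContinuousMap.abs_apply, abs_abs]; exact hbd n k)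
    (fun k => by
      simp only [ContinuousMap.abs_apply]
      simpa using (hpt k).abs) (δ / (‖f‖ * C + 1)) (by positivity)
  have hT : ∀ P, ‖TT e P b‖ ≤ δ / (‖f‖ * C + 1) := by
    classical
    intro P
    obtain ⟨g, hg, hgx⟩ := exists_dual_vector'' ℝ (TT e P b)
    have hgB : g ∈ Metric.closedBall (0 : StrongDual ℝ E) 1 := by
      exact (mem_closedBall_zero_iff (E := StrongDual ℝ E)).2 hg
    let k : K := (fun n => decide (n ∈ P), ⟨StrongDual.toWeakDual g, hgB⟩)
    have hk : {n | k.1 n = true} = P := by ext n; simp [k]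
    have e1 := (hb2 k).trans (hd k).le
    rw [hh, hk] at e1
    have e2 : (WeakDual.toStrongDual k.2.1) (TT e P b) = ‖TT e P b‖ := hgx
    rw [e2, abs_of_nonneg (norm_nonneg _)] at e1
    exact e1
  have e1 := james_lower hJ hes hC0 hC b _ hT
  have e2 := (le_abs_self _).trans (f.le_opNorm (Finsupp.linearCombination ℝ u b))
  have e3 := mul_le_mul_of_nonneg_left e1 (norm_nonneg f)
  have e4 : (δ / (‖f‖ * C + 1)) * (‖f‖ * C + 1) = δ := by field_simp
  have e5 : 0 < δ / (‖f‖ * C + 1) := by positivity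
  nlinarith

end


section
variable {X : Type*} [NormedAddCommGroup X] [NormedSpace ℝ X] {u : ℕ → X}

theorem hump_step {us : ℕ → X →L[ℝ] ℝ}
    (hexp : ∀ x, Tendsto (fun n => ∑ i ∈ Finset.range n, us i x • u i) atTop (𝓝 x))
    (S : X →L[ℝ] ℝ) (hS : ∀ i, S (u i) = 1) (w : ℕ → X) (a : ℝ)
    (hw : ∀ j, Tendsto (fun n => us j (w n)) atTop (𝓝 0))
    (hSw : Tendsto (fun n => S (w n)) atTop (𝓝 a)) (q N : ℕ) (δ : ℝ) (hδ : 0 < δ) :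
    ∃ (n q' : ℕ) (b : ℕ → ℝ), N < n ∧ q < q' ∧ S (∑ i ∈ Finset.Ico q q', b i • u i) = a ∧
      ‖w n - ∑ i ∈ Finset.Ico q q', b i • u i‖ < δ := by
  let PQ : ℕ → X := fun n => ∑ i ∈ Finset.range q, us i (w n) • u i
  have hPQ : Tendsto PQ atTop (𝓝 0) := by
    have := tendsto_finsetSum (Finset.range q) (fun i _ => (hw i).smul_const (u i))
    simpa using this
  have hR : Tendsto (fun n => ‖PQ n - (a - S (w n) + S (PQ n)) • u q‖) atTop (𝓝 0) := by
    have h2 : Tendsto (fun n => S (PQ n)) atTop (𝓝 0) := by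
      have h := (S.continuous.tendsto 0).comp hPQ
      rw [map_zero] at h
      exact h
    have h3 := (hPQ.sub ((((tendsto_const_nhds (x := a)).sub hSw).add h2).smul_const (u q))).norm
    simpa using h3
  obtain ⟨n, hn1, hn2⟩ := ((hR.eventually (gt_mem_nhds hδ)).and (eventually_gt_atTop N)).exists
  let z' : ℕ → X := fun q' => (∑ i ∈ Finset.range q', us i (w n) • u i) - PQ n
  have hz' : Tendsto z' atTop (𝓝 (w n - PQ n)) := (hexp (w n)).sub tendsto_const_nhds
  have hz : Tendsto (fun q' => ‖w n - (z' q' + (a - S (z' q')) • u q)‖) atTop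
      (𝓝 ‖PQ n - (a - S (w n) + S (PQ n)) • u q‖) := by
    have h2 : Tendsto (fun q' => S (z' q')) atTop (𝓝 (S (w n - PQ n))) :=
      (S.continuous.tendsto _).comp hz'
    have h3 := ((tendsto_const_nhds (x := w n)).sub
      (hz'.add (((tendsto_const_nhds (x := a)).sub h2).smul_const (u q)))).norm
    have h4 : w n - (w n - PQ n + (a - S (w n - PQ n)) • u q) =
        PQ n - (a - S (w n) + S (PQ n)) • u q := by
      rw [map_sub]; module
    rw [h4] at h3
    exact h3
  obtain ⟨q', hq1, hq2⟩ := ((hz.eventually (gt_mem_nhds hn1)).and (eventually_gt_atTop q)).exists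
  let b : ℕ → ℝ := fun i => us i (w n) + if i = q then a - S (z' q') else 0
  have hb : ∑ i ∈ Finset.Ico q q', b i • u i = z' q' + (a - S (z' q')) • u q := by
    simp only [b, add_smul, Finset.sum_add_distrib, ite_smul, zero_smul]
    congr 1
    · simp only [z', PQ]
      rw [← Finset.sum_range_add_sum_Ico _ hq2.le, add_sub_cancel_left]
    · rw [Finset.sum_ite_eq', if_pos (Finset.mem_Ico.2 ⟨le_rfl, hq2⟩)]
  refine ⟨n, q', b, hn2, hq2, ?_, ?_⟩
  · rw [hb, map_add, map_smul, hS]; simp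
  · rw [hb]; exact hq1

theorem hump {us : ℕ → X →L[ℝ] ℝ} (hbi : ∀ i a, us i (Finsupp.linearCombination ℝ u a) = a i)
    (D : ℝ) (hP : ∀ n x, ‖∑ i ∈ Finset.range n, us i x • u i‖ ≤ D * ‖x‖)
    (hexp : ∀ x, Tendsto (fun n => ∑ i ∈ Finset.range n, us i x • u i) atTop (𝓝 x))
    (S : X →L[ℝ] ℝ) (hS : ∀ i, S (u i) = 1) (w : ℕ → X) (a : ℝ) (ha : a ≠ 0)
    (hw : ∀ j, Tendsto (fun n => us j (w n)) atTop (𝓝 0))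
    (hSw : Tendsto (fun n => S (w n)) atTop (𝓝 a)) :
    ∃ ψ : ℕ → ℕ, StrictMono ψ ∧ ∃ z : ℕ → X, IsBlockBasis u z ∧
      EquivalentSeq (fun i => w (ψ i)) z ∧ ∀ i, S (z i) = a := by
  classical
  set K : ℝ := abs (‖S‖ * (2 * D) / |a|) with hK
  have hK0 : 0 ≤ K := abs_nonneg _
  set η : ℝ := 1 / (2 * K + 1) with hη
  have hη0 : 0 < η := by positivity
  have hKη : K * η ≤ 1 / 2 := by
    have : η * (2 * K + 1) = 1 := by rw [hη]; field_simp
    nlinarith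
  let δ : ℕ → ℝ := fun m => η / 2 / 2 ^ m
  have hδ : ∀ m, 0 < δ m := fun m => by positivity
  have hδs : ∀ s : Finset ℕ, ∑ m ∈ s, δ m ≤ η := by
    intro s
    have := (summable_geometric_two' η).sum_le_tsum s (fun m _ => (hδ m).le)
    rwa [tsum_geometric_two'] at this
  choose nn qq b hN hq hSb hwb using fun (m q N : ℕ) => hump_step hexp S hS w a hw hSw q N (δ m) (hδ m)
  let st : ℕ → ℕ × ℕ := fun m => Nat.rec (0, 0) (fun m p => (nn m p.2 p.1, qq m p.2 p.1)) m
  let q : ℕ → ℕ := fun m => (st m).2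
  let ψ : ℕ → ℕ := fun m => (st (m+1)).1
  let bb : ℕ → ℕ → ℝ := fun m => b m (st m).2 (st m).1
  have hqs : ∀ m, q m < q (m+1) := fun m => hq m _ _
  have hqm : StrictMono q := strictMono_nat_of_lt_succ hqs
  have hψ : StrictMono ψ := strictMono_nat_of_lt_succ (fun m => hN (m+1) _ _)
  let z : ℕ → X := fun m => ∑ i ∈ Finset.Ico (q m) (q (m+1)), bb m i • u i
  have hSz : ∀ m, S (z m) = a := fun m => hSb m _ _
  have hwz : ∀ m, ‖w (ψ m) - z m‖ ≤ δ m := fun m => (hwb m _ _).le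
  have huniq : ∀ i m m', i ∈ Finset.Ico (q m) (q (m+1)) → i ∈ Finset.Ico (q m') (q (m'+1)) →
      m = m' := by
    intro i m m' h h'
    rw [Finset.mem_Ico] at h h'
    rcases lt_trichotomy m m' with h3 | h3 | h3
    · have := hqm.monotone (show m + 1 ≤ m' from h3); omega
    · exact h3
    · have := hqm.monotone (show m' + 1 ≤ m from h3); omega
  let A : ℕ → ℝ := fun i => if h : ∃ m, i ∈ Finset.Ico (q m) (q (m+1)) then bb h.choose i else 0
  have hA : ∀ m i, i ∈ Finset.Ico (q m) (q (m+1)) → A i = bb m i := by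
    intro m i hi
    have h : ∃ m, i ∈ Finset.Ico (q m) (q (m+1)) := ⟨m, hi⟩
    simp only [A]
    rw [dif_pos h, huniq i _ m h.choose_spec hi]
  have hzA : ∀ m, z m = ∑ i ∈ Finset.Ico (q m) (q (m+1)), A i • u i := by
    intro m
    apply Finset.sum_congr rfl
    intro i hi
    rw [hA m i hi]
  have husz : ∀ i m, us i (z m) = if i ∈ Finset.Ico (q m) (q (m+1)) then A i else 0 := by
    intro i m
    rw [hzA, ← lc_tr, hbi, tr_apply]
  have hcoef : ∀ (s : Finset ℕ) (c : ℕ → ℝ), ∀ j ∈ s, |c j| ≤ K * ‖∑ m ∈ s, c m • z m‖ := by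
    intro s c j hj
    set x := ∑ m ∈ s, c m • z m with hx
    have hus : ∀ i ∈ Finset.Ico (q j) (q (j+1)), us i x = c j * A i := by
      intro i hi
      rw [hx, map_sum, Finset.sum_eq_single_of_mem j hj]
      · rw [map_smul, husz, if_pos hi]; rfl
      · intro m _ hm
        rw [map_smul, husz, if_neg (fun h => hm (huniq i _ _ h hi)), smul_zero]
    have h1 : c j • z j = (∑ i ∈ Finset.range (q (j+1)), us i x • u i) -
        ∑ i ∈ Finset.range (q j), us i x • u i := by
      rw [← Finset.sum_range_add_sum_Ico _ (hqs j).le, add_sub_cancel_left, hzA, Finset.smul_sum]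
      apply Finset.sum_congr rfl
      intro i hi
      rw [hus i hi, mul_smul]
    have h2 : ‖c j • z j‖ ≤ 2 * D * ‖x‖ := by
      rw [h1]
      refine (norm_sub_le _ _).trans ?_
      linarith [hP (q (j+1)) x, hP (q j) x]
    have h3 : |c j| * |a| ≤ ‖S‖ * (2 * D * ‖x‖) := by
      have h4 := S.le_opNorm (c j • z j)
      rw [map_smul, hSz, smul_eq_mul, norm_mul, Real.norm_eq_abs, Real.norm_eq_abs] at h4
      exact h4.trans (mul_le_mul_of_nonneg_left h2 (norm_nonneg _))
    have ha' : 0 < |a| := abs_pos.2 ha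
    have h4 : |c j| ≤ (‖S‖ * (2 * D) / |a|) * ‖x‖ := by
      rw [div_mul_eq_mul_div, le_div_iff₀ ha']
      linarith
    exact h4.trans (mul_le_mul_of_nonneg_right (le_abs_self _) (norm_nonneg _))
  have hdiff : ∀ (s : Finset ℕ) (c : ℕ → ℝ),
      ‖(∑ m ∈ s, c m • w (ψ m)) - ∑ m ∈ s, c m • z m‖ ≤ 1 / 2 * ‖∑ m ∈ s, c m • z m‖ := by
    intro s c
    rw [← Finset.sum_sub_distrib]
    refine (norm_sum_le _ _).trans ?_
    have h1 : ∀ m ∈ s, ‖c m • w (ψ m) - c m • z m‖ ≤ (K * ‖∑ m ∈ s, c m • z m‖) * δ m := by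
      intro m hm
      rw [← smul_sub, norm_smul, Real.norm_eq_abs]
      exact mul_le_mul (hcoef s c m hm) (hwz m) (norm_nonneg _) (by positivity)
    refine (Finset.sum_le_sum h1).trans ?_
    rw [← Finset.mul_sum]
    have h2 := mul_le_mul_of_nonneg_left (hδs s) (show 0 ≤ K * ‖∑ m ∈ s, c m • z m‖ by positivity)
    have h3 := mul_le_mul_of_nonneg_right hKη (norm_nonneg (∑ m ∈ s, c m • z m))
    linarith
  refine ⟨ψ, hψ, z, ⟨q, hqm, A, fun m => ⟨?_, hzA m⟩⟩, ⟨⟨2, ?_⟩, ⟨3 / 2, ?_⟩⟩, hSz⟩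
  · intro h
    apply ha
    rw [← hSz m, h, map_zero]
  · intro s c
    have h1 := hdiff s c
    have h2 := norm_sub_norm_le (∑ m ∈ s, c m • z m) (∑ m ∈ s, c m • w (ψ m))
    rw [norm_sub_rev] at h2
    linarith
  · intro s c
    have h1 := hdiff s c
    have h2 := norm_sub_norm_le (∑ m ∈ s, c m • w (ψ m)) (∑ m ∈ s, c m • z m)
    linarith

end


theorem subseq_aux {X : Type*} [NormedAddCommGroup X] [NormedSpace ℝ X] (us : ℕ → X →L[ℝ] ℝ)
    (S : X →L[ℝ] ℝ) (y : ℕ → X) (M : ℝ) (hM : ∀ n, ‖y n‖ ≤ M) :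
    ∃ φ : ℕ → ℕ, StrictMono φ ∧ ∃ (c : ℕ → ℝ) (s : ℝ),
      (∀ j, Tendsto (fun n => us j (y (φ n))) atTop (𝓝 (c j))) ∧
      Tendsto (fun n => S (y (φ n))) atTop (𝓝 s) := by
  have hb : ∀ (f : X →L[ℝ] ℝ) n, f (y n) ∈ Metric.closedBall (0:ℝ) (‖f‖ * M) := by
    intro f n
    rw [mem_closedBall_zero_iff]
    exact (f.le_opNorm _).trans (mul_le_mul_of_nonneg_left (hM n) (norm_nonneg _))
  have hc : IsCompact ((Set.univ.pi (fun j => Metric.closedBall (0:ℝ) (‖us j‖ * M))) ×ˢ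
      Metric.closedBall (0:ℝ) (‖S‖ * M)) :=
    (isCompact_univ_pi (fun j => isCompact_closedBall _ _)).prod (isCompact_closedBall _ _)
  obtain ⟨⟨c, s⟩, -, φ, hφ, h⟩ := hc.tendsto_subseq
    (x := fun n => ((fun j => us j (y n) : ℕ → ℝ), S (y n)))
    (fun n => ⟨fun j _ => hb (us j) n, hb S n⟩)
  refine ⟨φ, hφ, c, s, fun j => ?_, ?_⟩
  · exact (((continuous_apply j).comp continuous_fst).tendsto (c, s)).comp h
  · exact (continuous_snd.tendsto (c, s)).comp h

theorem approx_lc {X : Type*} [NormedAddCommGroup X] [NormedSpace ℝ X] {u : ℕ → X}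
    (hd : Dense (Submodule.span ℝ (Set.range u) : Set X)) (x : X) (δ : ℝ) (hδ : 0 < δ) :
    ∃ a : ℕ →₀ ℝ, ‖x - Finsupp.linearCombination ℝ u a‖ < δ := by
  obtain ⟨v, hv, h⟩ := hd.exists_dist_lt x hδ
  obtain ⟨a, rfl⟩ := (Finsupp.mem_span_range_iff_exists_finsupp).1 hv
  refine ⟨a, ?_⟩
  rw [dist_eq_norm] at h
  exact h

/-- Proposition 5(a) of the paper. -/
theorem statement6 {E X : Type*} [NormedAddCommGroup E] [NormedSpace ℝ E] [CompleteSpace E]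
    [NormedAddCommGroup X] [NormedSpace ℝ X] [CompleteSpace X]
    (e : ℕ → E) (hdense : Dense (Submodule.span ℝ (Set.range e) : Set E))
    (he : IsNormalizedUnconditionalBasic e) (hrefl : IsReflexiveSpace E)
    (u : ℕ → X) (hJ : IsJamesSpace e u)
    (S : X →L[ℝ] ℝ) (hS : ∀ i, S (u i) = 1)
    (y : ℕ → X) (hbdd : ∃ M : ℝ, ∀ n, ‖y n‖ ≤ M)
    (hnwc : ¬ ∃ φ : ℕ → ℕ, StrictMono φ ∧ ∃ y₀ : X, ∀ f : X →L[ℝ] ℝ,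
      Tendsto (fun n => f (y (φ n))) atTop (𝓝 (f y₀))) :
    ∃ φ : ℕ → ℕ, StrictMono φ ∧ ∃ (y₀ : X) (z : ℕ → X) (a : ℝ), a ≠ 0 ∧
      IsBlockBasis u z ∧ EquivalentSeq (fun i => y (φ i) - y₀) z ∧ ∀ i, S (z i) = a := by
  obtain ⟨h1, C, hU⟩ := he
  have hC0 : 0 ≤ C := by
    have := hU {0} {0} (Finset.Subset.refl _) (fun _ => 1)
    simp only [Finset.sum_singleton, one_smul, h1] at this
    linarith
  obtain ⟨es, hes0, hC, hconv⟩ := basis_package e hdense (fun i => (h1 i).ge) C hC0 (by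
    intro n a
    obtain ⟨N, hN, h⟩ := lc_range e a n
    rw [h]
    exact hU _ _ (Finset.range_subset_range.2 hN) _)
  have hes : ∀ i j, es i (e j) = if i = j then 1 else 0 := by
    intro i j
    have := hes0 i (Finsupp.single j 1)
    rw [Finsupp.linearCombination_single, one_smul, Finsupp.single_apply] at this
    rw [this]
    simp only [eq_comm]
  simp only [← QQ_apply] at hC hconv
  have hu1 : ∀ i, 1 ≤ ‖u i‖ := by
    intro i
    have := james_upper h1 hJ Set.univ (Finsupp.single i 1)
    rw [TT, Finsupp.linearCombination_single, Finsupp.linearCombination_single, one_smul,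
      one_smul, h1] at this
    exact this
  obtain ⟨us, hbi, hP, hexp⟩ := basis_package u hJ.1 hu1 (C * C) (by positivity)
    (james_proj h1 hJ hes hC0 hC)
  obtain ⟨M, hM⟩ := hbdd
  obtain ⟨φ, hφ, c, s, hc, hs⟩ := subseq_aux us S y M hM
  have hcb : ∀ n, ‖∑ j ∈ Finset.range n, c j • u j‖ ≤ C * C * M := by
    intro n
    have ht : Tendsto (fun m => ‖∑ j ∈ Finset.range n, us j (y (φ m)) • u j‖) atTop
        (𝓝 ‖∑ j ∈ Finset.range n, c j • u j‖) :=
      (tendsto_finsetSum _ (fun j _ => (hc j).smul_const (u j))).norm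
    refine le_of_tendsto' ht (fun m => (hP n _).trans ?_)
    exact mul_le_mul_of_nonneg_left (hM _) (by positivity)
  obtain ⟨y₀, hy₀⟩ := cauchySeq_tendsto_of_complete
    (bounded_complete hrefl h1 hJ hes hC0 hC hconv c _ hcb)
  have husy : ∀ j, us j y₀ = c j := by
    intro j
    have t := ((us j).continuous.tendsto y₀).comp hy₀
    refine tendsto_nhds_unique t ?_
    apply tendsto_const_nhds.congr'
    filter_upwards [eventually_gt_atTop j] with n hn
    rw [Function.comp_apply, ← lc_tr, hbi, tr_apply, if_pos (Finset.mem_range.2 hn)]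
  have hw : ∀ j, Tendsto (fun n => us j (y (φ n) - y₀)) atTop (𝓝 0) := by
    intro j
    have t := (hc j).sub_const (us j y₀)
    rw [husy, sub_self] at t
    refine t.congr (fun n => ?_)
    rw [map_sub, husy]
  have hSw : Tendsto (fun n => S (y (φ n) - y₀)) atTop (𝓝 (s - S y₀)) := by
    refine (hs.sub_const (S y₀)).congr (fun n => ?_)
    rw [map_sub]
  have ha : s - S y₀ ≠ 0 := by
    intro h0
    rw [h0] at hSw
    apply hnwc
    refine ⟨φ, hφ, y₀, ?_⟩
    have key : ∀ f : X →L[ℝ] ℝ, ∀ ε > 0, ∀ᶠ n in atTop, f (y (φ n) - y₀) < ε := by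
      intro f ε hε
      by_contra hcon
      have hfr : ∃ᶠ n in atTop, ε ≤ f (y (φ n) - y₀) := by
        intro hh
        apply hcon
        filter_upwards [hh] with n hn
        exact not_le.1 hn
      obtain ⟨ψ, hψ, hψf⟩ := extraction_of_frequently_atTop hfr
      set w : ℕ → X := fun n => y (φ (ψ n)) - y₀ with hwdef
      let δ : ℕ → ℝ := fun n => min 1 (ε / 2 / (‖f‖ + 1)) / ((n : ℝ) + 1)
      have hδ0 : 0 < min 1 (ε / 2 / (‖f‖ + 1)) := lt_min one_pos (by positivity)
      have hδ : ∀ n, 0 < δ n := fun n => by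
        have : (0:ℝ) < (n:ℝ) + 1 := by positivity
        exact div_pos hδ0 this
      have hδle : ∀ n, δ n ≤ min 1 (ε / 2 / (‖f‖ + 1)) := fun n => by
        apply div_le_self hδ0.le
        have : (0:ℝ) ≤ n := Nat.cast_nonneg n
        linarith
      have hδt : Tendsto δ atTop (𝓝 0) := by
        have := (tendsto_one_div_add_atTop_nhds_zero_nat (𝕜 := ℝ)).const_mul
          (min 1 (ε / 2 / (‖f‖ + 1)))
        rw [mul_zero] at this
        refine this.congr (fun n => ?_)
        rw [mul_one_div]
      choose a hab using fun n => approx_lc hJ.1 (w n) (δ n) (hδ n)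
      have hz : Tendsto (fun n => w n - Finsupp.linearCombination ℝ u (a n)) atTop (𝓝 0) :=
        squeeze_zero_norm (fun n => (hab n).le) hδt
      have hg : ∀ g : X →L[ℝ] ℝ, Tendsto (fun n => g (y (φ n) - y₀)) atTop (𝓝 0) →
          Tendsto (fun n => g (Finsupp.linearCombination ℝ u (a n))) atTop (𝓝 0) := by
        intro g hg0
        have t1 := hg0.comp hψ.tendsto_atTop
        have t2 := (g.continuous.tendsto 0).comp hz
        rw [map_zero] at t2
        have t3 := t1.sub t2
        rw [sub_zero] at t3
        refine t3.congr (fun n => ?_)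
        simp only [Function.comp_apply, map_sub, hwdef]
        ring
      have hab2 : ∀ n, ‖Finsupp.linearCombination ℝ u (a n)‖ ≤ M + ‖y₀‖ + 1 := by
        intro n
        have b1 := norm_sub_norm_le (Finsupp.linearCombination ℝ u (a n)) (w n)
        rw [norm_sub_rev _ (w n)] at b1
        have b2 : ‖w n‖ ≤ ‖y (φ (ψ n))‖ + ‖y₀‖ := norm_sub_le _ _
        have b3 := hM (φ (ψ n))
        have b4 := (hδle n).trans (min_le_left _ _)
        linarith [hab n]
      refine weak_null_X hrefl h1 hJ hes hC0 hC hconv a _ hab2 ?_ ?_ f (ε / 2) (by positivity) ?_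
      · intro j
        simpa only [hbi] using hg (us j) (hw j)
      · refine (hg S hSw).congr (fun n => ?_)
        rw [Finsupp.linearCombination_apply, Finsupp.linearCombination_apply, Finsupp.sum,
          Finsupp.sum, map_sum]
        apply Finset.sum_congr rfl
        intro j _
        rw [map_smul, hS]
      · intro n
        have b1 := (le_abs_self _).trans (f.le_opNorm (w n - Finsupp.linearCombination ℝ u (a n)))
        rw [map_sub] at b1
        have b2 := (hab n).le.trans ((hδle n).trans (min_le_right _ _))
        have b3 := mul_le_mul_of_nonneg_left b2 (norm_nonneg f)
        have b4 : ε / 2 / (‖f‖ + 1) * (‖f‖ + 1) = ε / 2 := by field_simp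
        have b5 : 0 < ε / 2 / (‖f‖ + 1) := by positivity
        have b6 : ε ≤ f (w n) := hψf n
        nlinarith
    intro f
    rw [Metric.tendsto_atTop']
    intro ε hε
    obtain ⟨N, hN⟩ := eventually_atTop.1 ((key f ε hε).and (key (-f) ε hε))
    refine ⟨N, fun n hn => ?_⟩
    obtain ⟨b1, b2⟩ := hN n hn.le
    rw [_root_.neg_apply] at b2
    rw [Real.dist_eq, ← map_sub, abs_lt]
    constructor <;> linarith
  obtain ⟨ψ, hψ, z, hz1, hz2, hz3⟩ := hump hbi (C * C) hP hexp S hS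
    (fun n => y (φ n) - y₀) _ ha hw hSw
  exact ⟨φ ∘ ψ, hφ.comp hψ, y₀, z, _, ha, hz1, hz2, hz3⟩
end

section
/- Let (e_i) be a normalized unconditional basis of a reflexive Banach space E, let X = J(e_i) be the James-type space over (e_i) with canonical basis (u_i), biorthogonal functionals (u_n'), basis projections P_m, and summing functional S. Let (y_n') be a bounded sequence in the closed linear span [u_n'] ⊆ X' with no weakly convergent subsequence. Then there exist a strictly increasing sequence (n_i) of indices, a vector y_0' ∈ [u_n'], integers 0 = k_0 < k_1 < k_2 < ⋯, vectors z_i' ∈ span{u_n' : k_{i−1} < n ≤ k_i}, and a real number b ≠ 0 such that ‖y_{n_i}' − y_0' − b·P_{k_{i−1}}'S − z_i'‖ → 0 as i → ∞, where P_m' denotes the adjoint of P_m. -/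
open Filter Topology

namespace JT

/-- last breakpoint at or before `n` -/
def ell (p : ℕ → Bool) : ℕ → ℕ
  | 0 => 0
  | n + 1 => bif p (n + 1) then n + 1 else ell p n

lemma ell_le (p : ℕ → Bool) (n : ℕ) : ell p n ≤ n := by
  induction n with
  | zero => simp [ell]
  | succ n ih =>
    rw [ell]; cases p (n + 1) <;> simp; omega

lemma le_ell (p : ℕ → Bool) {m n : ℕ} (hm : p m = true) (hmn : m ≤ n) : m ≤ ell p n := by
  induction n with
  | zero => simpa [ell] using hmn
  | succ n ih =>
    rw [ell]
    rcases Nat.lt_or_ge n m with h | h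
    · have : m = n + 1 := by omega
      subst this; simp [hm]
    · have := ih h
      cases p (n + 1) <;> simp <;> omega

lemma ell_self (p : ℕ → Bool) {m : ℕ} (hm : p m = true ∨ m = 0) : ell p m = m := by
  rcases hm with hm | rfl
  · exact le_antisymm (ell_le _ _) (le_ell _ hm le_rfl)
  · rfl

lemma ell_const (p : ℕ → Bool) {m n : ℕ} (hmn : m ≤ n)
    (h : ∀ x, m < x → x ≤ n → p x = false) : ell p n = ell p m := by
  induction n with
  | zero => have : m = 0 := by omega
            subst this; rfl
  | succ n ih =>
    rcases Nat.lt_or_ge n m with h' | h'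
    · have : m = n + 1 := by omega
      subst this; rfl
    · rw [ell, h (n + 1) (by omega) le_rfl, cond_false]
      exact ih h' fun x hx hx' => h x hx (by omega)

/-- agreement of `p` and `p'` on `[m, n]` with a breakpoint at `m`. -/
lemma ell_congr (p p' : ℕ → Bool) {m n : ℕ} (hmn : m ≤ n) (hm : p m = true)
    (h : ∀ x, m ≤ x → x ≤ n → p x = p' x) : ell p n = ell p' n := by
  induction n with
  | zero => rfl
  | succ n ih =>
    rw [ell, ell, h (n + 1) hmn le_rfl]
    rcases Nat.lt_or_ge n m with h' | h'
    · have : m = n + 1 := by omega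
      subst this
      simp [← h (n + 1) le_rfl le_rfl, hm]
    · rw [ih h' fun x hx hx' => h x hx (by omega)]

variable {E : Type*} [NormedAddCommGroup E] [NormedSpace ℝ E]

lemma jsum_eq (e : ℕ → E) (a : ℕ → ℝ) (p : ℕ → Bool) (q : ℕ → ℕ) (hq : StrictMono q)
    (hq0 : q 0 = 0) (k : ℕ)
    (h : ∀ i < k, ∀ j ∈ Finset.Ico (q i) (q (i + 1)), ell p j = q i) :
    ∑ i ∈ Finset.range k, (∑ j ∈ Finset.Ico (q i) (q (i + 1)), a j) • e (q i) =
      ∑ j ∈ Finset.range (q k), a j • e (ell p j) := by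
  induction k with
  | zero => simp [hq0]
  | succ k ih =>
    rw [Finset.sum_range_succ, ih fun i hi => h i (by omega)]
    rw [← Finset.sum_range_add_sum_Ico _ (hq.monotone (Nat.le_succ k)), Finset.sum_smul]
    congr 1
    refine Finset.sum_congr rfl fun j hj => ?_
    rw [h k (by omega) j hj]

lemma jsum_eq_range (e : ℕ → E) (a : ℕ → ℝ) (q : ℕ → ℕ) (hq : StrictMono q)
    (hq0 : q 0 = 0) (k : ℕ) : ∃ p : ℕ → Bool,
    ∑ i ∈ Finset.range k, (∑ j ∈ Finset.Ico (q i) (q (i + 1)), a j) • e (q i) =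
      ∑ j ∈ Finset.range (q k), a j • e (ell p j) := by
  classical
  refine ⟨fun x => decide (x ∈ Set.range q), jsum_eq e a _ q hq hq0 k ?_⟩
  intro i _ j hj
  rw [Finset.mem_Ico] at hj
  rw [ell_const _ hj.1, ell_self]
  · left; simp
  · intro x hx hx'
    simp only [decide_eq_false_iff_not]
    rintro ⟨l, rfl⟩
    rw [hq.lt_iff_lt] at hx
    have : q l < q (i + 1) := by omega
    rw [hq.lt_iff_lt] at this
    omega

lemma norm_lsum_le (e : ℕ → E) (he : ∀ i, ‖e i‖ = 1) (a : ℕ →₀ ℝ) (p : ℕ → Bool) (s : Finset ℕ) :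
    ‖∑ j ∈ s, a j • e (ell p j)‖ ≤ ∑ j ∈ a.support, |a j| := by
  refine (norm_sum_le _ _).trans ?_
  simp only [norm_smul, he, mul_one, Real.norm_eq_abs]
  have : ∑ j ∈ s, |a j| = ∑ j ∈ s ∩ a.support, |a j| := by
    symm
    apply Finset.sum_subset Finset.inter_subset_left
    intro x hx hx'
    simp only [Finset.mem_inter, hx, true_and, Finsupp.mem_support_iff, not_not] at hx'
    simp [hx']
  rw [this]
  exact Finset.sum_le_sum_of_subset_of_nonneg Finset.inter_subset_right fun _ _ _ => abs_nonneg _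

lemma jamesNorm_le (e : ℕ → E) (a : ℕ → ℝ) (B : ℝ)
    (h : ∀ p m, ‖∑ j ∈ Finset.range m, a j • e (ell p j)‖ ≤ B) : jamesNorm e a ≤ B := by
  apply csSup_le
  · exact ⟨_, 1, id, one_pos, rfl, strictMono_id, rfl⟩
  · rintro x ⟨k, q, _, hq0, hq, rfl⟩
    obtain ⟨p, hp⟩ := jsum_eq_range e a q hq hq0 k
    rw [hp]; exact h _ _

lemma le_jamesNorm (e : ℕ → E) (he : ∀ i, ‖e i‖ = 1) (a : ℕ →₀ ℝ) (p : ℕ → Bool) (m : ℕ) :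
    ‖∑ j ∈ Finset.range m, a j • e (ell p j)‖ ≤ jamesNorm e a := by
  rcases Nat.eq_zero_or_pos m with rfl | hm
  · simp only [Finset.range_zero, Finset.sum_empty, norm_zero]
    apply Real.sSup_nonneg
    rintro x ⟨k, q, _, hq0, hq, rfl⟩
    positivity
  apply le_csSup
  · refine ⟨∑ j ∈ a.support, |a j|, ?_⟩
    rintro x ⟨k, q, _, hq0, hq, rfl⟩
    obtain ⟨p, hp⟩ := jsum_eq_range e a q hq hq0 k
    rw [hp]; exact norm_lsum_le e he a _ _
  · let pp : ℕ → Prop := fun x => x = 0 ∨ m ≤ x ∨ p x = true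
    have hinf : (Set.ofPred pp).Infinite := by
      apply (Set.Ici_infinite m).mono
      intro x hx; right; left; exact hx
    have hq := Nat.nth_strictMono hinf
    have hr := Nat.range_nth_of_infinite hinf
    have hmr : m ∈ Set.range (Nat.nth pp) := by rw [hr]; right; left; exact le_rfl
    have h0r : 0 ∈ Set.range (Nat.nth pp) := by rw [hr]; left; rfl
    obtain ⟨k, hk⟩ := hmr
    have hq0 : Nat.nth pp 0 = 0 := by
      obtain ⟨l, hl⟩ := h0r
      have := hq.monotone (Nat.zero_le l)
      omega
    refine ⟨k, Nat.nth pp, ?_, hq0, hq, ?_⟩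
    · rcases Nat.eq_zero_or_pos k with rfl | h
      · omega
      · exact h
    rw [jsum_eq e a p _ hq hq0 k, hk]
    intro i hi j hj
    rw [Finset.mem_Ico] at hj
    have h1 : Nat.nth pp i < m := by rw [← hk]; exact hq hi
    have h2 : pp (Nat.nth pp i) := Nat.nth_mem_of_infinite hinf i
    rw [ell_const _ hj.1, ell_self]
    · rcases h2 with h | h | h
      · right; exact h
      · omega
      · left; exact h
    · intro x hx hx'
      by_contra hne
      have : x ∈ Set.range (Nat.nth pp) := by
        rw [hr]; right; right; simpa using hne
      obtain ⟨l, rfl⟩ := this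
      rw [hq.lt_iff_lt] at hx
      have : Nat.nth pp l < Nat.nth pp (i + 1) := by omega
      rw [hq.lt_iff_lt] at this
      omega


/-- reflexive spaces: bounded sequences converge weakly along ultrafilters -/
lemma weak_ultra (hrefl : IsReflexiveSpace E) (v : ℕ → E) (M : ℝ) (hv : ∀ n, ‖v n‖ ≤ M)
    (U : Ultrafilter ℕ) : ∃ v₀ : E, ∀ f : E →L[ℝ] ℝ,
      Tendsto (fun n => f (v n)) U (𝓝 (f v₀)) := by
  have hc := WeakDual.isCompact_closedBall (𝕜 := ℝ) (E := E →L[ℝ] ℝ) 0 M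
  let w : ℕ → WeakDual ℝ (E →L[ℝ] ℝ) := fun n =>
    StrongDual.toWeakDual (NormedSpace.inclusionInDoubleDual ℝ E (v n))
  have hw : ∀ n, w n ∈ WeakDual.toStrongDual ⁻¹' Metric.closedBall (0 : StrongDual ℝ (E →L[ℝ] ℝ)) M := by
    intro n
    refine (mem_closedBall_zero_iff (E := StrongDual ℝ (StrongDual ℝ E))).2 ?_
    exact (NormedSpace.double_dual_bound ℝ E (v n)).trans (hv n)
  obtain ⟨F, -, hF⟩ := hc.ultrafilter_le_nhds (U.map w)
    (by
      rw [Filter.le_principal_iff, Ultrafilter.mem_coe, Ultrafilter.mem_map]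
      exact Filter.mem_of_superset Filter.univ_mem fun n _ => hw n)
  obtain ⟨v₀, hv₀⟩ := hrefl (WeakDual.toStrongDual F)
  refine ⟨v₀, fun f => ?_⟩
  have h1 : Tendsto w U (𝓝 F) := hF
  have h2 := ((WeakDual.eval_continuous f).tendsto F).comp h1
  have h3 : F f = f v₀ := by
    have := congrArg (fun G => G f) hv₀
    simpa [NormedSpace.dual_def] using this.symm
  rw [← h3]
  exact h2

lemma exists_proj [CompleteSpace E] (e : ℕ → E)
    (hdense : Dense (Submodule.span ℝ (Set.range e) : Set E))
    (C : ℝ) (hC : ∀ S F : Finset ℕ, S ⊆ F → ∀ a : ℕ → ℝ,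
      ‖∑ i ∈ S, a i • e i‖ ≤ C * ‖∑ i ∈ F, a i • e i‖) :
    ∃ Q : ℕ → E →L[ℝ] E, (∀ m i, Q m (e i) = if i < m then e i else 0) ∧
      (∀ m x, ‖Q m x‖ ≤ C * ‖x‖) ∧ ∀ x, Tendsto (fun m => Q m x) atTop (𝓝 x) := by
  let L : (ℕ →₀ ℝ) →ₗ[ℝ] E := Finsupp.linearCombination ℝ e
  let L' : ℕ → (ℕ →₀ ℝ) →ₗ[ℝ] E := fun m =>
    Finsupp.linearCombination ℝ (fun i => if i < m then e i else 0)
  have hL : DenseRange L := by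
    have : Set.range L = (Submodule.span ℝ (Set.range e) : Set E) := by
      rw [← Finsupp.range_linearCombination]; rfl
    rw [DenseRange, this]; exact hdense
  have hb : ∀ m x, ‖L' m x‖ ≤ C * ‖L x‖ := by
    intro m x
    have h1 : L' m x = ∑ i ∈ x.support.filter (· < m), x i • e i := by
      simp only [L', Finsupp.linearCombination_apply, Finsupp.sum]
      rw [Finset.sum_filter]
      refine Finset.sum_congr rfl fun i _ => ?_
      split_ifs <;> simp
    rw [h1]
    exact hC _ _ (Finset.filter_subset _ _) x
  have hQ : ∀ m x, (L' m).extendOfNorm L (L x) = L' m x := fun m x =>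
    LinearMap.extendOfNorm_eq hL ⟨C, hb m⟩ x
  have hQb : ∀ m x, ‖(L' m).extendOfNorm L x‖ ≤ C * ‖x‖ := fun m x =>
    LinearMap.norm_extendOfNorm_apply_le hL C (hb m) x
  refine ⟨fun m => (L' m).extendOfNorm L, ?_, hQb, ?_⟩
  · intro m i
    have := hQ m (Finsupp.single i 1)
    simpa [L, L'] using this
  · intro x
    have hC0 : 0 ≤ |C| := abs_nonneg C
    rw [Metric.tendsto_atTop]
    intro ε hε
    obtain ⟨y, ⟨a, rfl⟩, hy⟩ := Metric.mem_closure_iff.1 (hL x) (ε / (|C| + 2)) (by positivity)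
    obtain ⟨N, hN⟩ : ∃ N, ∀ i ∈ a.support, i < N :=
      ⟨a.support.sup id + 1, fun i hi => Nat.lt_succ_of_le (Finset.le_sup (f := id) hi)⟩
    refine ⟨N, fun m hm => ?_⟩
    have h1 : (L' m).extendOfNorm L (L a) = L a := by
      rw [hQ]
      simp only [L, L', Finsupp.linearCombination_apply, Finsupp.sum]
      refine Finset.sum_congr rfl fun i hi => ?_
      rw [if_pos ((hN i hi).trans_le hm)]
    have h2 := hQb m (x - L a)
    rw [map_sub, h1] at h2
    rw [dist_eq_norm] at hy ⊢
    have h3 : (L' m).extendOfNorm L x - x = ((L' m).extendOfNorm L x - L a) - (x - L a) := by abel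
    rw [h3]
    have h4 : C * ‖x - L a‖ ≤ |C| * ‖x - L a‖ := by gcongr; exact le_abs_self C
    have h5 := norm_sub_le ((L' m).extendOfNorm L x - L a) (x - L a)
    have h6 : (|C| + 2) * ‖x - L a‖ < ε := by
      rw [lt_div_iff₀ (by positivity)] at hy; linarith
    have := norm_nonneg (x - L a)
    linarith

/-- bounded completeness in the reflexive space -/
lemma blocks_tendsto [CompleteSpace E] (hrefl : IsReflexiveSpace E) (Q : ℕ → E →L[ℝ] E)
    (hQl : ∀ x, Tendsto (fun m => Q m x) atTop (𝓝 x)) (N : ℕ → ℕ) (hN : StrictMono N)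
    (s : ℕ → E) (M : ℝ) (hs : ∀ n, ‖s n‖ ≤ M)
    (hQs : ∀ i j, i ≤ j → Q (N i) (s j) = s i) : ∃ x, Tendsto s atTop (𝓝 x) := by
  obtain ⟨x, hx⟩ := weak_ultra hrefl s M hs (Filter.hyperfilter ℕ)
  have hU : (Filter.hyperfilter ℕ : Filter ℕ) ≤ atTop := Nat.hyperfilter_le_atTop
  have : ∀ i, Q (N i) x = s i := by
    intro i
    apply (SeparatingDual.eq_iff_forall_dual_eq (R := ℝ)).2
    intro f
    have h1 := hx (f.comp (Q (N i)))
    have h2 : Tendsto (fun n => (f.comp (Q (N i))) (s n)) (Filter.hyperfilter ℕ) (𝓝 (f (s i))) := by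
      apply tendsto_const_nhds.congr'
      apply hU
      filter_upwards [eventually_ge_atTop i] with j hj
      simp [hQs i j hj]
    exact tendsto_nhds_unique h1 h2
  refine ⟨x, ?_⟩
  have := (hQl x).comp hN.tendsto_atTop
  refine this.congr fun i => ?_
  simp [‹∀ i, Q (N i) x = s i› i]

lemma weak_null (hrefl : IsReflexiveSpace E) (Q : ℕ → E →L[ℝ] E)
    (hQl : ∀ x, Tendsto (fun m => Q m x) atTop (𝓝 x))
    (v : ℕ → E) (M : ℝ) (hv : ∀ n, ‖v n‖ ≤ M)
    (hQv : ∀ n, ∃ m ≥ n, ∀ᶠ j in atTop, Q m (v j) = 0) (f : E →L[ℝ] ℝ) :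
    Tendsto (fun n => f (v n)) atTop (𝓝 0) := by
  rw [tendsto_iff_ultrafilter]
  intro U hU
  obtain ⟨x, hx⟩ := weak_ultra hrefl v M hv U
  choose m hm hmz using hQv
  have h0 : ∀ n, Q (m n) x = 0 := by
    intro n
    apply (SeparatingDual.eq_iff_forall_dual_eq (R := ℝ)).2
    intro g
    have h1 := hx (g.comp (Q (m n)))
    have h2 : Tendsto (fun j => (g.comp (Q (m n))) (v j)) U (𝓝 (g 0)) := by
      apply tendsto_const_nhds.congr'
      apply hU
      filter_upwards [hmz n] with j hj
      simp [hj]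
    exact tendsto_nhds_unique h1 h2
  have hx0 : x = 0 := by
    have h1 := (hQl x).comp (tendsto_atTop_mono hm tendsto_id)
    refine tendsto_nhds_unique h1 ?_
    refine tendsto_const_nhds.congr fun n => ?_
    simp [h0 n]
  have := hx f
  rw [hx0, map_zero] at this
  exact this


open MeasureTheory in
lemma riesz_null {K V : Type*} [TopologicalSpace K] [CompactSpace K] [T2Space K] [Nonempty K]
    [AddCommGroup V] [Module ℝ V] (T : V →ₗ[ℝ] C(K, ℝ)) (f : V →ₗ[ℝ] ℝ) (B : ℝ) (hB : 0 ≤ B)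
    (hf : ∀ a c, (∀ k, T a k ≤ c) → f a ≤ B * c) (a : ℕ → V) (M : ℝ)
    (hM : ∀ j k, |T (a j) k| ≤ M) (h0 : ∀ k, Tendsto (fun j => T (a j) k) atTop (𝓝 0)) :
    Tendsto (fun j => f (a j)) atTop (𝓝 0) := by
  let N : V × C(K, ℝ) → ℝ := fun x => B * ⨆ k, (T x.1 + x.2) k
  have hbdd : ∀ g : C(K, ℝ), BddAbove (Set.range g) := fun g =>
    (isCompact_range g.continuous).bddAbove
  let F : V × C(K, ℝ) →ₗ.[ℝ] ℝ :=
    { domain := LinearMap.range (LinearMap.inl ℝ V C(K, ℝ))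
      toFun := (f.comp (LinearMap.fst ℝ V C(K, ℝ))).comp (Submodule.subtype _) }
  obtain ⟨L, hL, hLN⟩ := exists_extension_of_le_sublinear F N
    (by
      intro c hc x
      simp only [N]
      have : ∀ k, (T (c • x).1 + (c • x).2) k = c * (T x.1 + x.2) k := by
        intro k; simp [mul_add]
      simp_rw [this]
      rw [← Real.mul_iSup_of_nonneg hc.le]; ring)
    (by
      intro x y
      simp only [N]
      rw [← mul_add]
      apply mul_le_mul_of_nonneg_left _ hB
      apply ciSup_le
      intro k
      have h1 := le_ciSup (hbdd (T x.1 + x.2)) k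
      have h2 := le_ciSup (hbdd (T y.1 + y.2)) k
      have : (T (x + y).1 + (x + y).2) k = (T x.1 + x.2) k + (T y.1 + y.2) k := by
        simp; ring
      rw [this]; exact add_le_add h1 h2)
    (by
      rintro ⟨x, v, rfl⟩
      simp only [F, N]
      refine hf _ _ fun k => ?_
      have := le_ciSup (hbdd (T v + 0)) k
      simpa using this)
  have hLf : ∀ v, L (v, 0) = f v := fun v => by
    have := hL ⟨(v, 0), v, rfl⟩
    simpa [F] using this
  have hneg : ∀ v, L (v, - T v) ≤ 0 := fun v => by
    have := hLN (v, - T v)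
    simpa [N] using this
  have hLT : ∀ v, f v = L (0, T v) := by
    intro v
    have h1 := hneg v
    have h2 := hneg (-v)
    have h3 : ((-v, - T (-v)) : V × C(K, ℝ)) = - (v, - T v) := by simp
    rw [h3, map_neg] at h2
    have h4 : ((v, 0) : V × C(K, ℝ)) = (v, - T v) + (0, T v) := by simp
    have h5 := hLf v
    rw [h4, map_add] at h5
    linarith
  have hpos : ∀ g : C(K, ℝ), (∀ k, 0 ≤ g k) → 0 ≤ L (0, g) := by
    intro g hg
    have h1 := hLN (0, -g)
    have h2 : N (0, -g) ≤ 0 := by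
      simp only [N]
      apply mul_nonpos_of_nonneg_of_nonpos hB
      apply ciSup_le
      intro k; simpa using hg k
    have h3 : ((0, -g) : V × C(K, ℝ)) = - (0, g) := by simp
    rw [h3, map_neg] at h1
    rw [h3] at h2
    linarith
  let _ : MeasurableSpace K := borel K
  have : BorelSpace K := ⟨rfl⟩
  let Λ₀ : CompactlySupportedContinuousMap K ℝ →ₗ[ℝ] ℝ :=
    { toFun := fun g => L (0, g.toContinuousMap)
      map_add' := fun g h => by
        rw [← map_add]; congr 1; ext1; · simp
        rfl
      map_smul' := fun c g => by
        rw [RingHom.id_apply, ← map_smul]; congr 1; ext1; · simp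
        rfl }
  let Λ : CompactlySupportedContinuousMap K ℝ →ₚ[ℝ] ℝ :=
    PositiveLinearMap.mk₀ Λ₀ (fun g hg => hpos _ fun k => hg k)
  let cc : C(K, ℝ) → CompactlySupportedContinuousMap K ℝ :=
    CompactlySupportedContinuousMap.continuousMapEquiv
  have hΛ : ∀ v, f v = ∫ k, T v k ∂(RealRMK.rieszMeasure Λ) := by
    intro v
    have h1 := RealRMK.integral_rieszMeasure Λ (cc (T v))
    rw [hLT]
    exact h1.symm
  simp_rw [hΛ]
  have : (0 : ℝ) = ∫ k, (0 : ℝ) ∂(RealRMK.rieszMeasure Λ) := by simp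
  rw [this]
  apply tendsto_integral_of_dominated_convergence (fun _ => M)
  · intro n
    exact (T (a n)).continuous.measurable.aestronglyMeasurable
  · exact integrable_const M
  · intro n; exact Eventually.of_forall fun k => by rw [Real.norm_eq_abs]; exact hM n k
  · exact Eventually.of_forall h0


lemma ell_congr' (p p' : ℕ → Bool) {n : ℕ}
    (h : ∀ x, x ≤ n → p x = p' x) : ell p n = ell p' n := by
  induction n with
  | zero => rfl
  | succ n ih => rw [ell, ell, h (n + 1) le_rfl, ih fun x hx => h x (by omega)]

lemma proj_lsum (e : ℕ → E) (Q : ℕ → E →L[ℝ] E) (hQ : ∀ m i, Q m (e i) = if i < m then e i else 0)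
    (a : ℕ → ℝ) (p : ℕ → Bool) (m N : ℕ) (hm : p m = true) (hmN : m ≤ N) :
    Q m (∑ j ∈ Finset.range N, a j • e (ell p j)) = ∑ j ∈ Finset.range m, a j • e (ell p j) := by
  rw [map_sum, ← Finset.sum_range_add_sum_Ico _ hmN]
  have h1 : ∑ j ∈ Finset.range m, Q m (a j • e (ell p j)) =
      ∑ j ∈ Finset.range m, a j • e (ell p j) := by
    refine Finset.sum_congr rfl fun j hj => ?_
    rw [Finset.mem_range] at hj
    rw [map_smul, hQ, if_pos ((ell_le p j).trans_lt hj)]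
  have h2 : ∑ j ∈ Finset.Ico m N, Q m (a j • e (ell p j)) = 0 := by
    refine Finset.sum_eq_zero fun j hj => ?_
    rw [Finset.mem_Ico] at hj
    rw [map_smul, hQ, if_neg (not_lt.2 (le_ell p hm hj.1)), smul_zero]
  rw [h1, h2, add_zero]

lemma exists_supp_bound (a : ℕ →₀ ℝ) : ∃ N, a.support ⊆ Finset.range N :=
  ⟨a.support.sup id + 1, fun i hi =>
    Finset.mem_range.2 (Nat.lt_succ_of_le (Finset.le_sup (f := id) hi))⟩

lemma supp_sum (a : ℕ →₀ ℝ) {F : Type*} [AddCommGroup F] [Module ℝ F] (g : ℕ → F) {N : ℕ}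
    (h : a.support ⊆ Finset.range N) :
    ∑ i ∈ a.support, a i • g i = ∑ i ∈ Finset.range N, a i • g i := by
  apply Finset.sum_subset h
  intro x _ hx
  simp only [Finsupp.mem_support_iff, not_not] at hx
  simp [hx]

lemma continuous_ell (i : ℕ) : Continuous fun p : ℕ → Bool => ell p i := by
  induction i with
  | zero => simpa [ell] using continuous_const
  | succ n ih =>
    have : (fun p : ℕ → Bool => ell p (n + 1)) =
        (fun x : Bool × ℕ => bif x.1 then n + 1 else x.2) ∘ fun p => (p (n + 1), ell p n) := by
      funext p; simp [ell]
    rw [this]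
    exact continuous_of_discreteTopology.comp ((continuous_apply _).prodMk ih)

lemma james_null (e : ℕ → E) (he : ∀ i, ‖e i‖ = 1) (hrefl : IsReflexiveSpace E)
    (Q : ℕ → E →L[ℝ] E) (hQ : ∀ m i, Q m (e i) = if i < m then e i else 0)
    (hQl : ∀ x, Tendsto (fun m => Q m x) atTop (𝓝 x))
    (C : ℝ) (hC : 0 ≤ C) (hQb : ∀ m x, ‖Q m x‖ ≤ C * ‖x‖)
    (f : (ℕ →₀ ℝ) →ₗ[ℝ] ℝ) (B : ℝ) (hB : 0 ≤ B) (hf : ∀ a, f a ≤ B * jamesNorm e a)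
    (a : ℕ → ℕ →₀ ℝ) (M : ℝ) (ha : ∀ j, jamesNorm e (a j) ≤ M)
    (hsupp : ∀ j i, i < j → a j i = 0) (hsum : ∀ j, ∑ i ∈ (a j).support, a j i = 0) :
    Tendsto (fun j => f (a j)) atTop (𝓝 0) := by
  let D : Set (WeakDual ℝ E) := WeakDual.toStrongDual ⁻¹' Metric.closedBall (0 : StrongDual ℝ E) 1
  have hD : CompactSpace D :=
    isCompact_iff_compactSpace.1 (WeakDual.isCompact_closedBall (𝕜 := ℝ) (E := E) 0 1)
  have hmemD : ∀ φ : StrongDual ℝ E, ‖φ‖ ≤ 1 → StrongDual.toWeakDual φ ∈ D := fun φ hφ =>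
    (mem_closedBall_zero_iff (E := StrongDual ℝ E)).2 hφ
  have hnormD : ∀ φ : D, ‖WeakDual.toStrongDual φ.1‖ ≤ 1 := fun φ =>
    (mem_closedBall_zero_iff (E := StrongDual ℝ E)).1 φ.2
  have : Nonempty D := ⟨⟨_, hmemD 0 (by simp)⟩⟩
  let G : ℕ → C((ℕ → Bool) × D, ℝ) := fun i =>
    { toFun := fun k => (k.2 : WeakDual ℝ E) (e (ell k.1 i))
      continuous_toFun := by
        have h1 : Continuous fun x : ℕ × D => (x.2 : WeakDual ℝ E) (e x.1) := by
          rw [continuous_prod_of_discrete_left]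
          intro n
          exact (WeakDual.eval_continuous (e n)).comp continuous_subtype_val
        exact h1.comp (((continuous_ell i).comp continuous_fst).prodMk continuous_snd) }
  let T := Finsupp.linearCombination ℝ G
  have hT : ∀ (a : ℕ →₀ ℝ) p (φ : D), T a (p, φ) =
      WeakDual.toStrongDual φ.1 (∑ i ∈ a.support, a i • e (ell p i)) := by
    intro a p φ
    simp only [T, Finsupp.linearCombination_apply, Finsupp.sum, map_sum, map_smul]
    rw [ContinuousMap.coe_sum, Finset.sum_apply]
    rfl
  have hbd : ∀ j p, ‖∑ i ∈ (a j).support, a j i • e (ell p i)‖ ≤ M := by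
    intro j p
    obtain ⟨N, hN⟩ := exists_supp_bound (a j)
    rw [supp_sum (a j) (fun i => e (ell p i)) hN]
    exact (le_jamesNorm e he (a j) p N).trans (ha j)
  refine riesz_null T f (B * C) (by positivity) ?_ a M ?_ ?_
  · intro b c hbc
    have hc : ∀ p, ‖∑ i ∈ b.support, b i • e (ell p i)‖ ≤ c := by
      intro p
      obtain ⟨φ, hφ, hφe⟩ := exists_dual_vector'' ℝ (∑ i ∈ b.support, b i • e (ell p i))
      have h1 := hbc (p, ⟨_, hmemD φ hφ⟩)
      rw [hT] at h1
      have h2 : WeakDual.toStrongDual (StrongDual.toWeakDual φ) = φ := by simp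
      simp only [h2] at h1
      rw [hφe] at h1
      simpa using h1
    have hj : jamesNorm e b ≤ C * c := by
      apply jamesNorm_le
      intro p m
      obtain ⟨N, hN⟩ := exists_supp_bound b
      let p' : ℕ → Bool := fun x => p x || decide (x = m)
      have hN' : b.support ⊆ Finset.range (max m N) :=
        hN.trans (Finset.range_mono (le_max_right _ _))
      have h1 := proj_lsum e Q hQ b p' m (max m N) (by simp [p']) (le_max_left _ _)
      have h2 : ∑ j ∈ Finset.range m, b j • e (ell p' j) =
          ∑ j ∈ Finset.range m, b j • e (ell p j) := by
        refine Finset.sum_congr rfl fun j hj => ?_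
        rw [Finset.mem_range] at hj
        rw [ell_congr' p' p]
        intro x hx
        have : x ≠ m := by omega
        simp [p', this]
      rw [← h2, ← h1, ← supp_sum b (fun i => e (ell p' i)) hN']
      refine (hQb _ _).trans ?_
      exact mul_le_mul_of_nonneg_left (hc p') hC
    calc f b ≤ B * jamesNorm e b := hf b
      _ ≤ B * (C * c) := by gcongr
      _ = B * C * c := by ring
  · rintro j ⟨p, φ⟩
    rw [hT, ← Real.norm_eq_abs]
    refine ((WeakDual.toStrongDual φ.1).le_opNorm _).trans ?_
    have := hbd j p
    have h2 := hnormD φ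
    calc _ ≤ 1 * ‖∑ i ∈ (a j).support, a j i • e (ell p i)‖ := by gcongr
      _ ≤ M := by rw [one_mul]; exact this
  · rintro ⟨p, φ⟩
    simp_rw [hT]
    by_cases hp : ∀ n, ∃ m ≥ n, p m = true
    · refine weak_null hrefl Q hQl _ M (fun j => hbd j p) ?_ _
      intro n
      obtain ⟨m, hm, hpm⟩ := hp n
      refine ⟨m, hm, ?_⟩
      filter_upwards [eventually_ge_atTop m] with j hj
      rw [map_sum]
      refine Finset.sum_eq_zero fun i hi => ?_
      have hij : j ≤ i := by
        by_contra hlt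
        exact (Finsupp.mem_support_iff.1 hi) (hsupp j i (by omega))
      rw [map_smul, hQ, if_neg (not_lt.2 (le_ell p hpm (hj.trans hij))), smul_zero]
    · push Not at hp
      obtain ⟨n, hn⟩ := hp
      apply tendsto_const_nhds.congr'
      filter_upwards [eventually_ge_atTop n] with j hj
      have h1 : ∑ i ∈ (a j).support, a j i • e (ell p i) =
          ∑ i ∈ (a j).support, a j i • e (ell p n) := by
        refine Finset.sum_congr rfl fun i hi => ?_
        have hij : j ≤ i := by
          by_contra hlt
          exact (Finsupp.mem_support_iff.1 hi) (hsupp j i (by omega))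
        rw [ell_const p (hj.trans hij)]
        intro x hx _
        simpa using hn x hx.le
      rw [h1, ← Finset.sum_smul, hsum j, zero_smul, map_zero]


lemma cauchy_aux [CompleteSpace E] (e : ℕ → E) (hrefl : IsReflexiveSpace E)
    (Q : ℕ → E →L[ℝ] E) (hQ : ∀ m i, Q m (e i) = if i < m then e i else 0)
    (hQl : ∀ x, Tendsto (fun m => Q m x) atTop (𝓝 x))
    (C : ℝ) (hQb : ∀ m x, ‖Q m x‖ ≤ C * ‖x‖)
    (a : ℕ → ℝ) (M : ℝ) (h : ∀ p m, ‖∑ j ∈ Finset.range m, a j • e (ell p j)‖ ≤ M)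
    (ε : ℝ) (hε : 0 < ε) : ∃ N, ∀ m ≥ N, ∀ n, ∀ p : ℕ → Bool, p m = true →
      ‖∑ j ∈ Finset.Ico m n, a j • e (ell p j)‖ ≤ ε := by
  by_contra hcon
  push Not at hcon
  choose mm hmm nn pp hpp hlt using hcon
  have hmn : ∀ N, mm N < nn N := by
    intro N
    by_contra hge
    have := hlt N
    rw [Finset.Ico_eq_empty (by omega), Finset.sum_empty, norm_zero] at this
    linarith
  obtain ⟨N, hNs⟩ : ∃ N : ℕ → ℕ, ∀ j, N (j + 1) = nn (N j) :=
    ⟨fun j => Nat.rec 0 (fun _ x => nn x) j, fun j => rfl⟩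
  have hmN : ∀ j, mm (N j) < N (j + 1) := fun j => by rw [hNs]; exact hmn _
  have hN : StrictMono N := strictMono_nat_of_lt_succ fun j => by
    rw [hNs]; exact (hmm (N j)).trans_lt (hmn (N j))
  classical
  let P : ℕ → Bool := fun x =>
    decide (∃ j, x = N j ∨ (mm (N j) ≤ x ∧ x < N (j + 1) ∧ pp (N j) x = true))
  have hPN : ∀ j, P (N j) = true := fun j => by
    simp only [P, decide_eq_true_eq]; exact ⟨j, Or.inl rfl⟩
  have hPm : ∀ j, P (mm (N j)) = true := fun j => by
    simp only [P, decide_eq_true_eq]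
    exact ⟨j, Or.inr ⟨le_rfl, hmN _, hpp _⟩⟩
  have hagree : ∀ j x, mm (N j) ≤ x → x < N (j + 1) → P x = pp (N j) x := by
    intro j x hx hx'
    rw [Bool.eq_iff_iff]
    simp only [P, decide_eq_true_eq]
    constructor
    · rintro ⟨l, hl⟩
      have h1 := hmm (N j)
      have h2 := hmm (N l)
      have hlj : l = j := by
        have h3 : N l < N (j + 1) := by rcases hl with hl | hl <;> omega
        have h4 : N j < N (l + 1) := by
          rcases hl with hl | hl
          · have := hN (Nat.lt_succ_self l)
            simp only [Nat.succ_eq_add_one] at this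
            omega
          · omega
        rw [hN.lt_iff_lt] at h3 h4
        omega
      subst hlj
      rcases hl with hl | hl
      · have : x = mm (N l) := by omega
        rw [this]; exact hpp _
      · exact hl.2.2
    · intro hp
      exact ⟨j, Or.inr ⟨hx, hx', hp⟩⟩
  let s : ℕ → E := fun j => ∑ i ∈ Finset.range (N j), a i • e (ell P i)
  obtain ⟨x, hx⟩ := blocks_tendsto hrefl Q hQl N hN s M (fun n => h _ _)
    (fun i j hij => proj_lsum e Q hQ a P (N i) (N j) (hPN i) (hN.monotone hij))
  let t : ℕ → E := fun j => Q (mm (N j)) (s (j + 1))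
  have ht : ∀ j, t j = ∑ i ∈ Finset.range (mm (N j)), a i • e (ell P i) := fun j =>
    proj_lsum e Q hQ a P _ _ (hPm j) (hmN _).le
  have hmt : Tendsto (fun j => mm (N j)) atTop atTop :=
    tendsto_atTop_mono (fun j => (hN.id_le j).trans (hmm _)) tendsto_id
  have hs1 : Tendsto (fun j => s (j + 1)) atTop (𝓝 x) := (tendsto_add_atTop_iff_nat 1).2 hx
  have htx : Tendsto t atTop (𝓝 x) := by
    have h1 : Tendsto (fun j => Q (mm (N j)) (s (j + 1) - x)) atTop (𝓝 0) := by
      apply squeeze_zero_norm (fun j => hQb _ _)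
      have : Tendsto (fun j => ‖s (j + 1) - x‖) atTop (𝓝 0) :=
        tendsto_iff_norm_sub_tendsto_zero.1 hs1
      simpa using this.const_mul C
    have h2 := h1.add ((hQl x).comp hmt)
    rw [zero_add] at h2
    refine h2.congr fun j => ?_
    simp [t, map_sub]
  have hd := hs1.sub htx
  rw [sub_self] at hd
  have hd' := hd.norm
  rw [norm_zero] at hd'
  obtain ⟨j, hj⟩ := (hd'.eventually (gt_mem_nhds hε)).exists
  have hj2 : s (j + 1) - t j =
      ∑ i ∈ Finset.Ico (mm (N j)) (nn (N j)), a i • e (ell (pp (N j)) i) := by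
    rw [ht]
    simp only [s]
    rw [← Finset.sum_range_add_sum_Ico _ (hmN j).le, add_sub_cancel_left, hNs]
    refine Finset.sum_congr rfl fun i hi => ?_
    rw [Finset.mem_Ico] at hi
    rw [ell_congr P (pp (N j)) hi.1 (hPm j)]
    intro y hy hy'
    exact hagree j y hy (by rw [hNs]; omega)
  rw [hj2] at hj
  exact absurd hj (not_lt.2 (hlt (N j)).le)

lemma cauchy_james [CompleteSpace E] (e : ℕ → E) (he : ∀ i, ‖e i‖ = 1) (hrefl : IsReflexiveSpace E)
    (Q : ℕ → E →L[ℝ] E) (hQ : ∀ m i, Q m (e i) = if i < m then e i else 0)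
    (hQl : ∀ x, Tendsto (fun m => Q m x) atTop (𝓝 x))
    (C : ℝ) (hQb : ∀ m x, ‖Q m x‖ ≤ C * ‖x‖)
    (a : ℕ → ℝ) (M : ℝ) (h : ∀ p m, ‖∑ j ∈ Finset.range m, a j • e (ell p j)‖ ≤ M)
    (ε : ℝ) (hε : 0 < ε) : ∃ N, ∀ m ≥ N, ∀ n, ∀ p : ℕ → Bool,
      ‖∑ j ∈ Finset.Ico m n, a j • e (ell p j)‖ ≤ ε := by
  obtain ⟨N, hN⟩ := cauchy_aux e hrefl Q hQ hQl C hQb a M h (ε / 2) (by positivity)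
  refine ⟨N, fun m hm n p => ?_⟩
  rcases Nat.lt_or_ge n m with hnm | hmn
  · rw [Finset.Ico_eq_empty (by omega), Finset.sum_empty, norm_zero]; exact hε.le
  obtain ⟨r, hmr, hrn, hrp, hr⟩ : ∃ r, m ≤ r ∧ r ≤ n ∧ (∀ x, m ≤ x → x < r → p x = false) ∧
      (r = n ∨ p r = true) := by
    classical
    have hex : ∃ r, m ≤ r ∧ (r = n ∨ p r = true) := ⟨n, hmn, Or.inl rfl⟩
    refine ⟨Nat.find hex, (Nat.find_spec hex).1, Nat.find_min' hex ⟨hmn, Or.inl rfl⟩, ?_,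
      (Nat.find_spec hex).2⟩
    intro x hx hx'
    have := Nat.find_min hex hx'
    push Not at this
    simpa using (this hx).2
  rw [← Finset.sum_Ico_consecutive _ hmr hrn]
  refine (norm_add_le _ _).trans ?_
  have h1 : ‖∑ j ∈ Finset.Ico m r, a j • e (ell p j)‖ ≤ ε / 2 := by
    have h2 := hN m hm r (fun x => decide (x = m)) (by simp)
    have h3 : ∑ j ∈ Finset.Ico m r, a j • e (ell (fun x => decide (x = m)) j) =
        (∑ j ∈ Finset.Ico m r, a j) • e m := by
      rw [Finset.sum_smul]
      refine Finset.sum_congr rfl fun j hj => ?_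
      rw [Finset.mem_Ico] at hj
      rw [ell_const _ hj.1, ell_self]
      · left; simp
      · intro x hx _; simp; omega
    have h4 : ∑ j ∈ Finset.Ico m r, a j • e (ell p j) =
        (∑ j ∈ Finset.Ico m r, a j) • e (ell p m) := by
      rw [Finset.sum_smul]
      refine Finset.sum_congr rfl fun j hj => ?_
      rw [Finset.mem_Ico] at hj
      rw [ell_const _ hj.1]
      intro x hx hx'; exact hrp x hx.le (by omega)
    rw [h3, norm_smul, he] at h2
    rw [h4, norm_smul, he]
    exact h2
  have h2 : ‖∑ j ∈ Finset.Ico r n, a j • e (ell p j)‖ ≤ ε / 2 := by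
    rcases hr with rfl | hr
    · simp; positivity
    · exact hN r (by omega) n p hr
  linarith


section X
variable {X : Type*} [NormedAddCommGroup X] [NormedSpace ℝ X]
  (e : ℕ → E) (he : ∀ i, ‖e i‖ = 1) (u : ℕ → X) (hJ : IsJamesSpace e u)
  (u' : ℕ → X →L[ℝ] ℝ) (hu' : ∀ i j, u' i (u j) = if i = j then 1 else 0)
  (P : ℕ → X →L[ℝ] X) (hP : ∀ m i, P m (u i) = if i < m then u i else 0)
  (S : X →L[ℝ] ℝ) (hS : ∀ i, S (u i) = 1)

lemma L_norm (hJ : IsJamesSpace e u) (a : ℕ →₀ ℝ) :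
    ‖Finsupp.linearCombination ℝ u a‖ = jamesNorm e a := by
  rw [Finsupp.linearCombination_apply]; exact hJ.2 a

lemma L_dense (hJ : IsJamesSpace e u) : DenseRange (Finsupp.linearCombination ℝ u) := by
  have : Set.range (Finsupp.linearCombination ℝ u) = (Submodule.span ℝ (Set.range u) : Set X) := by
    rw [← Finsupp.range_linearCombination]; rfl
  rw [DenseRange, this]; exact hJ.1

include hP in
lemma P_L (m : ℕ) (a : ℕ →₀ ℝ) : P m (Finsupp.linearCombination ℝ u a) =
    Finsupp.linearCombination ℝ u (a.filter (· < m)) := by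
  induction a using Finsupp.induction_linear with
  | zero => rw [map_zero, map_zero, Finsupp.filter_zero, map_zero]
  | add f g hf hg => rw [map_add, map_add, hf, hg, Finsupp.filter_add, map_add]
  | single i c =>
    by_cases h : i < m <;> simp [hP, h]

include he hJ hP in
lemma P_norm (m : ℕ) (x : X) : ‖P m x‖ ≤ ‖x‖ := by
  refine isClosed_property (p := fun x => ‖P m x‖ ≤ ‖x‖) (L_dense e u hJ)
    (isClosed_le (by fun_prop) (by fun_prop)) ?_ x
  intro a
  rw [P_L u P hP, L_norm e u hJ, L_norm e u hJ]
  apply jamesNorm_le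
  intro p n
  refine le_trans (le_of_eq ?_) (le_jamesNorm e he a p (min n m))
  congr 1
  have h1 : Finset.range (min n m) = (Finset.range n).filter (· < m) := by
    ext x; simp
  rw [h1, Finset.sum_filter]
  refine Finset.sum_congr rfl fun j _ => ?_
  by_cases h : j < m <;> simp [h]

include he hJ in
lemma u_norm (i : ℕ) : ‖u i‖ ≤ 1 := by
  have h1 := L_norm e u hJ (Finsupp.single i 1)
  simp only [Finsupp.linearCombination_single, one_smul] at h1
  rw [h1]
  apply jamesNorm_le
  intro p m
  refine (norm_lsum_le e he _ _ _).trans ?_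
  rw [Finsupp.support_single_ne_zero _ one_ne_zero]
  simp

include hu' in
lemma u'_L (i : ℕ) (a : ℕ →₀ ℝ) : u' i (Finsupp.linearCombination ℝ u a) = a i := by
  rw [Finsupp.linearCombination_apply, Finsupp.sum, map_sum]
  simp [hu']
  exact fun h => h.symm

include hJ in
lemma clm_ext {F : Type*} [NormedAddCommGroup F] [NormedSpace ℝ F] {f g : X →L[ℝ] F}
    (h : ∀ i, f (u i) = g (u i)) : f = g :=
  ContinuousLinearMap.ext_on hJ.1 (by rintro _ ⟨i, rfl⟩; exact h i)

include hJ hu' hP in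
lemma comp_P (f : X →L[ℝ] ℝ) (m : ℕ) :
    f.comp (P m) = ∑ i ∈ Finset.range m, f (u i) • u' i := by
  apply clm_ext e u hJ
  intro j
  rw [ContinuousLinearMap.comp_apply, hP, ContinuousLinearMap.sum_apply]
  simp only [ContinuousLinearMap.smul_apply, hu', smul_eq_mul, mul_ite, mul_one, mul_zero,
    Finset.sum_ite_eq', Finset.mem_range]
  split_ifs <;> simp

include hJ hP in
lemma P_P {m n : ℕ} (h : m ≤ n) (x : X) : P m (P n x) = P m x := by
  have : (P m).comp (P n) = P m := by
    apply clm_ext e u hJ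
    intro i
    rw [ContinuousLinearMap.comp_apply, hP n]
    split_ifs with h1
    · rfl
    · rw [map_zero, hP, if_neg (by omega)]
  exact DFunLike.congr_fun this x

include he hJ hu' hP in
lemma Y_tail (w : X →L[ℝ] ℝ) (hw : w ∈ (Submodule.span ℝ (Set.range u')).topologicalClosure) :
    Tendsto (fun m => ‖w - w.comp (P m)‖) atTop (𝓝 0) := by
  have hPn : ∀ m, ‖P m‖ ≤ 1 := fun m =>
    (P m).opNorm_le_bound zero_le_one fun x => by
      rw [one_mul]; exact P_norm e he u hJ P hP m x
  have hspan : ∀ v ∈ Submodule.span ℝ (Set.range u'), ∀ᶠ m in atTop, v.comp (P m) = v := by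
    intro v hv
    induction hv using Submodule.span_induction with
    | mem v hv =>
      obtain ⟨i, rfl⟩ := hv
      filter_upwards [eventually_gt_atTop i] with m hm
      apply clm_ext e u hJ
      intro j
      rw [ContinuousLinearMap.comp_apply, hP]
      split_ifs with h
      · rfl
      · rw [hu', if_neg (by omega), map_zero]
    | zero => simp
    | add v w _ _ hv hw =>
      filter_upwards [hv, hw] with m h1 h2
      rw [ContinuousLinearMap.add_comp, h1, h2]
    | smul c v _ hv =>
      filter_upwards [hv] with m h1
      rw [ContinuousLinearMap.smul_comp, h1]
  rw [Metric.tendsto_nhds]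
  intro ε hε
  obtain ⟨v, hv, hwv⟩ := Metric.mem_closure_iff.1 hw (ε / 2) (by positivity)
  filter_upwards [hspan v hv] with m hm
  rw [dist_zero_right, norm_norm]
  have h1 : w - w.comp (P m) = (w - v) - (w - v).comp (P m) := by
    rw [ContinuousLinearMap.sub_comp, hm]; abel
  rw [h1]
  rw [dist_eq_norm] at hwv
  have h2 := norm_sub_le (w - v) ((w - v).comp (P m))
  have h3 := (w - v).opNorm_comp_le (P m)
  have h4 : ‖w - v‖ * ‖P m‖ ≤ ‖w - v‖ * 1 := by gcongr; exact hPn m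
  linarith

include he hJ hu' hP hS in
lemma dual_decomp
    (hnull : ∀ (f : X →L[ℝ] ℝ) (a : ℕ → ℕ →₀ ℝ) (M : ℝ), (∀ j, jamesNorm e (a j) ≤ M) →
      (∀ j i, i < j → a j i = 0) → (∀ j, ∑ i ∈ (a j).support, a j i = 0) →
      Tendsto (fun j => f (Finsupp.linearCombination ℝ u (a j))) atTop (𝓝 0))
    (f : X →L[ℝ] ℝ) : ∃ b : ℝ, f - b • S ∈ (Submodule.span ℝ (Set.range u')).topologicalClosure := by
  have hnull' : ∀ (x : ℕ → X) (M : ℝ), (∀ j, ‖x j‖ ≤ M) →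
      (∀ j, x j ∈ Set.range (Finsupp.linearCombination ℝ u)) → (∀ j, P j (x j) = 0) →
      (∀ j, S (x j) = 0) → Tendsto (fun j => f (x j)) atTop (𝓝 0) := by
    intro x M hM hx hPx hSx
    choose a ha using hx
    have := hnull f a M (fun j => by rw [← L_norm e u hJ, ha]; exact hM j) ?_ ?_
    · simpa only [ha] using this
    · intro j i hij
      have h1 := hPx j
      rw [← ha, P_L u P hP] at h1
      have h2 := congrArg (u' i) h1
      rw [u'_L u u' hu', map_zero] at h2
      simpa [hij] using h2
    · intro j
      have h1 := hSx j
      rw [← ha, Finsupp.linearCombination_apply, Finsupp.sum, map_sum] at h1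
      simpa [hS] using h1
  have hmemu : ∀ i, u i ∈ Set.range (Finsupp.linearCombination ℝ u) := fun i =>
    ⟨Finsupp.single i 1, by simp⟩
  have hcau : CauchySeq fun n => f (u n) := by
    rw [Metric.cauchySeq_iff]
    by_contra hcon
    push Not at hcon
    obtain ⟨ε, hε, hcon⟩ := hcon
    choose m hm n hn hmn using hcon
    have h1 := hnull' (fun j => u (m j) - u (n j)) 2
      (fun j => (norm_sub_le _ _).trans (by
        have := u_norm e he u hJ (m j); have := u_norm e he u hJ (n j); linarith))
      (fun j => by
        obtain ⟨a, ha⟩ := hmemu (m j); obtain ⟨b, hb⟩ := hmemu (n j)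
        exact ⟨a - b, by rw [map_sub, ha, hb]⟩)
      (fun j => by
        rw [map_sub, hP, hP, if_neg (not_lt.2 (hm j)), if_neg (not_lt.2 (hn j)), sub_zero])
      (fun j => by rw [map_sub, hS, hS, sub_self])
    have h2 := h1.norm
    rw [norm_zero] at h2
    obtain ⟨j, hj⟩ := (h2.eventually (gt_mem_nhds hε)).exists
    have h3 := hmn j
    rw [dist_eq_norm, ← map_sub] at h3
    linarith
  obtain ⟨b, hb⟩ := cauchySeq_tendsto_of_complete hcau
  refine ⟨b, ?_⟩
  let g := f - b • S
  have hgu : Tendsto (fun n => g (u n)) atTop (𝓝 0) := by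
    have := hb.sub_const b
    rw [sub_self] at this
    refine this.congr fun n => ?_
    simp [g, hS]
  have hg : Tendsto (fun m => ‖g - g.comp (P m)‖) atTop (𝓝 0) := by
    rw [Metric.tendsto_atTop]
    by_contra hcon
    push Not at hcon
    obtain ⟨ε, hε, hcon⟩ := hcon
    choose m hm hmε using hcon
    have hex : ∀ j, ∃ x ∈ Set.range (Finsupp.linearCombination ℝ u), ‖x‖ ≤ 1 ∧
        ε / 2 ≤ |g (x - P (m j) x)| := by
      intro j
      by_contra hno
      push Not at hno
      have h1 : ‖g - g.comp (P (m j))‖ ≤ ε / 2 := by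
        refine ContinuousLinearMap.opNorm_le_bound _ (by positivity) fun x => ?_
        refine isClosed_property
          (p := fun x => ‖(g - g.comp (P (m j))) x‖ ≤ ε / 2 * ‖x‖) (L_dense e u hJ)
          (isClosed_le (by fun_prop) (by fun_prop)) ?_ x
        intro a
        set y := Finsupp.linearCombination ℝ u a with hy
        rcases eq_or_ne y 0 with h0 | h0
        · simp [h0]
        have hpos : 0 < ‖y‖ := norm_pos_iff.2 h0
        have h2 := hno (‖y‖⁻¹ • y) ⟨‖y‖⁻¹ • a, by rw [map_smul]⟩
          (by rw [norm_smul, norm_inv, norm_norm, inv_mul_cancel₀ hpos.ne'])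
        rw [map_smul, ← smul_sub, map_smul, smul_eq_mul, abs_mul, abs_of_pos (inv_pos.2 hpos),
          inv_mul_lt_iff₀ hpos] at h2
        rw [ContinuousLinearMap.sub_apply, ContinuousLinearMap.comp_apply, ← map_sub,
          Real.norm_eq_abs]
        linarith
      have h2 := hmε j
      rw [dist_zero_right, norm_norm] at h2
      linarith
    choose x hxr hx1 hxε using hex
    let w : ℕ → X := fun j => x j - P (m j) (x j)
    have hw2 : ∀ j, ‖w j‖ ≤ 2 := fun j => (norm_sub_le _ _).trans (by
      have := P_norm e he u hJ P hP (m j) (x j); have := hx1 j; linarith)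
    have hSw : ∀ j, |S (w j)| ≤ ‖S‖ * 2 := fun j =>
      (S.le_opNorm _).trans (by gcongr; exact hw2 j)
    have h1 := hnull' (fun j => w j - S (w j) • u (m j)) (2 + ‖S‖ * 2)
      (fun j => (norm_sub_le _ _).trans (by
        rw [norm_smul, Real.norm_eq_abs]
        have h1 := u_norm e he u hJ (m j)
        have h2 : |S (w j)| * ‖u (m j)‖ ≤ (‖S‖ * 2) * 1 := by
          gcongr; exact hSw j
        have := hw2 j; linarith))
      (fun j => by
        obtain ⟨a, ha⟩ := hxr j
        refine ⟨a - a.filter (· < m j) - S (w j) • Finsupp.single (m j) 1, ?_⟩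
        rw [map_sub, map_sub, ← P_L u P hP, ha, map_smul]
        simp [w])
      (fun j => by
        rw [map_sub, map_sub, P_P e u hJ P hP (hm j), map_smul, hP, if_neg (not_lt.2 (hm j))]
        simp)
      (fun j => by rw [map_sub, map_smul, hS]; simp)
    have h2 : Tendsto (fun j => |f (w j - S (w j) • u (m j))| + ‖S‖ * 2 * |g (u (m j))|) atTop
        (𝓝 0) := by
      have h3 := hgu.comp (tendsto_atTop_mono hm tendsto_id)
      have h4 := h1.abs.add (h3.abs.const_mul (‖S‖ * 2))
      simpa using h4
    obtain ⟨j, hj⟩ := (h2.eventually (gt_mem_nhds (half_pos hε))).exists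
    have h3 : f (w j - S (w j) • u (m j)) = g (w j) - S (w j) * g (u (m j)) := by
      simp [g, hS]; ring
    have h4 := hxε j
    have h5 : |g (w j)| ≤ |f (w j - S (w j) • u (m j))| + |S (w j)| * |g (u (m j))| := by
      rw [h3, ← abs_mul]
      have := abs_add_le (g (w j) - S (w j) * g (u (m j))) (S (w j) * g (u (m j)))
      simpa using this
    have h6 : |S (w j)| * |g (u (m j))| ≤ ‖S‖ * 2 * |g (u (m j))| := by
      gcongr; exact hSw j
    simp only [w] at h5 hj h6
    linarith
  have hg2 : Tendsto (fun m => g.comp (P m)) atTop (𝓝 g) := by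
    rw [tendsto_iff_norm_sub_tendsto_zero]
    refine hg.congr fun m => norm_sub_rev _ _
  refine mem_closure_of_tendsto hg2 (Eventually.of_forall fun m => ?_)
  rw [comp_P e u hJ u' hu' P hP]
  exact Submodule.sum_mem _ fun i _ => Submodule.smul_mem _ _
    (Submodule.subset_span ⟨i, rfl⟩)

include he hJ hu' hP in
lemma predual [CompleteSpace X]
    (hcau : ∀ (a : ℕ → ℝ) (M : ℝ), (∀ p m, ‖∑ j ∈ Finset.range m, a j • e (ell p j)‖ ≤ M) →
      ∀ ε : ℝ, 0 < ε → ∃ N, ∀ m ≥ N, ∀ n, ∀ p : ℕ → Bool,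
        ‖∑ j ∈ Finset.Ico m n, a j • e (ell p j)‖ ≤ ε)
    (F : (X →L[ℝ] ℝ) →L[ℝ] ℝ) : ∃ x : X,
      ∀ y ∈ (Submodule.span ℝ (Set.range u')).topologicalClosure, F y = y x := by
  let a : ℕ → ℝ := fun i => F (u' i)
  let A : ℕ → ℕ →₀ ℝ := fun n => Finsupp.indicator (Finset.range n) fun i _ => a i
  have hA : ∀ n i, A n i = if i < n then a i else 0 := by
    intro n i; simp [A, Finsupp.indicator_apply]
  let x : ℕ → X := fun n => Finsupp.linearCombination ℝ u (A n)
  have hxs : ∀ n, x n = ∑ i ∈ Finset.range n, a i • u i := by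
    intro n
    have hsub : (A n).support ⊆ Finset.range n := by
      intro i hi
      rw [Finsupp.mem_support_iff, hA] at hi
      rw [Finset.mem_range]; by_contra h; simp [h] at hi
    simp only [x]
    rw [Finsupp.linearCombination_apply, Finsupp.sum, supp_sum (A n) u hsub]
    refine Finset.sum_congr rfl fun i hi => ?_
    rw [hA, if_pos (Finset.mem_range.1 hi)]
  have hxn : ∀ n, ‖x n‖ ≤ ‖F‖ := by
    intro n
    obtain ⟨f, hf, hfx⟩ := exists_dual_vector'' ℝ (x n)
    have h1 : f (x n) = F (f.comp (P n)) := by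
      rw [comp_P e u hJ u' hu' P hP, hxs]
      simp [a, mul_comm]
    have h2 : ‖f.comp (P n)‖ ≤ 1 := by
      refine ContinuousLinearMap.opNorm_le_bound _ zero_le_one fun z => ?_
      rw [ContinuousLinearMap.comp_apply]
      refine (f.le_opNorm _).trans ?_
      have := P_norm e he u hJ P hP n z
      gcongr
    have h3 : ‖x n‖ = f (x n) := by rw [hfx]; simp
    rw [h3, h1]
    refine (le_abs_self _).trans ((F.le_opNorm _).trans ?_)
    nlinarith [norm_nonneg F]
  have hb : ∀ p m, ‖∑ j ∈ Finset.range m, a j • e (ell p j)‖ ≤ ‖F‖ := by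
    intro p m
    refine le_trans ?_ (hxn m)
    simp only [x]
    rw [L_norm e u hJ]
    refine le_trans (le_of_eq ?_) (le_jamesNorm e he (A m) p m)
    congr 1
    refine Finset.sum_congr rfl fun i hi => ?_
    rw [hA, if_pos (Finset.mem_range.1 hi)]
  have hc : CauchySeq x := by
    rw [Metric.cauchySeq_iff']
    intro ε hε
    obtain ⟨N, hN⟩ := hcau a _ hb (ε / 2) (by positivity)
    refine ⟨N, fun n hn => ?_⟩
    rw [dist_eq_norm]
    simp only [x]
    rw [← map_sub, L_norm e u hJ]
    refine lt_of_le_of_lt (jamesNorm_le e _ (ε / 2) ?_) (half_lt_self hε)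
    intro p m
    refine le_trans (le_of_eq ?_) (hN N le_rfl (min n m) p)
    congr 1
    have h1 : Finset.Ico N (min n m) = (Finset.range m).filter (fun j => N ≤ j ∧ j < n) := by
      ext x; simp; tauto
    rw [h1, Finset.sum_filter]
    refine Finset.sum_congr rfl fun j _ => ?_
    rw [Finsupp.sub_apply, hA, hA]
    by_cases h1 : j < N
    · have h2 : j < n := by omega
      have h3 : ¬ (N ≤ j) := by omega
      simp [h1, h2, h3]
    · have h3 : N ≤ j := by omega
      by_cases h2 : j < n <;> simp [h1, h2, h3]
  obtain ⟨x₀, hx₀⟩ := cauchySeq_tendsto_of_complete hc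
  refine ⟨x₀, fun y hy => ?_⟩
  have hu0 : ∀ i, F (u' i) = u' i x₀ := by
    intro i
    refine tendsto_nhds_unique ?_ (((u' i).continuous.tendsto x₀).comp hx₀)
    apply tendsto_const_nhds.congr'
    filter_upwards [eventually_gt_atTop i] with n hn
    simp only [Function.comp, x]
    rw [u'_L u u' hu', hA, if_pos hn]
  have hcl : IsClosed {y : X →L[ℝ] ℝ | F y = y x₀} :=
    isClosed_eq F.continuous (ContinuousLinearMap.apply ℝ ℝ x₀).continuous
  have hsub : (Submodule.span ℝ (Set.range u') : Set (X →L[ℝ] ℝ)) ⊆ {y | F y = y x₀} := by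
    intro y hy
    induction hy using Submodule.span_induction with
    | mem v hv => obtain ⟨i, rfl⟩ := hv; exact hu0 i
    | zero => simp
    | add v w _ _ hv hw =>
      simp only [Set.mem_ofPred_eq] at *
      rw [map_add, hv, hw, ContinuousLinearMap.add_apply]
    | smul c v _ hv =>
      simp only [Set.mem_ofPred_eq] at *
      rw [map_smul, hv, ContinuousLinearMap.smul_apply]
  exact closure_minimal hsub hcl hy

end X


end JT


/-- Proposition 5(b) of the paper. -/
theorem statement7 {E X : Type*} [NormedAddCommGroup E] [NormedSpace ℝ E] [CompleteSpace E]
    [NormedAddCommGroup X] [NormedSpace ℝ X] [CompleteSpace X]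
    (e : ℕ → E) (hdense : Dense (Submodule.span ℝ (Set.range e) : Set E))
    (he : IsNormalizedUnconditionalBasic e) (hrefl : IsReflexiveSpace E)
    (u : ℕ → X) (hJ : IsJamesSpace e u)
    (u' : ℕ → X →L[ℝ] ℝ) (hu' : ∀ i j, u' i (u j) = if i = j then 1 else 0)
    (P : ℕ → X →L[ℝ] X) (hP : ∀ m i, P m (u i) = if i < m then u i else 0)
    (S : X →L[ℝ] ℝ) (hS : ∀ i, S (u i) = 1)
    (y' : ℕ → X →L[ℝ] ℝ)
    (hmem : ∀ n, y' n ∈ (Submodule.span ℝ (Set.range u')).topologicalClosure)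
    (hbdd : ∃ M : ℝ, ∀ n, ‖y' n‖ ≤ M)
    (hnwc : ¬ ∃ φ : ℕ → ℕ, StrictMono φ ∧ ∃ g₀ : X →L[ℝ] ℝ,
      ∀ F : (X →L[ℝ] ℝ) →L[ℝ] ℝ, Tendsto (fun n => F (y' (φ n))) atTop (𝓝 (F g₀))) :
    ∃ φ : ℕ → ℕ, StrictMono φ ∧
      ∃ y₀' ∈ (Submodule.span ℝ (Set.range u')).topologicalClosure,
      ∃ k : ℕ → ℕ, k 0 = 0 ∧ StrictMono k ∧
      ∃ z' : ℕ → X →L[ℝ] ℝ,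
        (∀ i, z' i ∈ Submodule.span ℝ (u' '' Set.Ico (k i) (k (i + 1)))) ∧
      ∃ b : ℝ, b ≠ 0 ∧
        Tendsto (fun i => ‖y' (φ i) - y₀' - b • (S.comp (P (k i))) - z' i‖) atTop (𝓝 0) := by
  obtain ⟨he1, C, hC⟩ := he
  have hC0 : 0 ≤ C := by
    have h := hC {0} {0} subset_rfl (fun _ => 1)
    simp [he1] at h
    linarith
  obtain ⟨Q, hQ, hQb, hQl⟩ := JT.exists_proj e hdense C hC
  have hdec := JT.dual_decomp e he1 u hJ u' hu' P hP S hS (fun f a M ha hs hz =>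
    JT.james_null e he1 hrefl Q hQ hQl C hC0 hQb
      (f.toLinearMap.comp (Finsupp.linearCombination ℝ u)) ‖f‖ (norm_nonneg _)
      (fun a => by
        rw [← JT.L_norm e u hJ]
        exact (le_abs_self _).trans (f.le_opNorm _)) a M ha hs hz)
  have hpre := JT.predual e he1 u hJ u' hu' P hP
    (JT.cauchy_james e he1 hrefl Q hQ hQl C hQb)
  obtain ⟨M, hM⟩ := hbdd
  have hsep : TopologicalSpace.SeparableSpace X := by
    have h1 : TopologicalSpace.IsSeparable (Set.range u) :=
      (Set.countable_range u).isSeparable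
    have h2 : TopologicalSpace.IsSeparable
        (closure (Submodule.span ℝ (Set.range u) : Set X)) := h1.span.closure
    rw [hJ.1.closure_eq] at h2
    exact TopologicalSpace.isSeparable_univ_iff.1 h2
  obtain ⟨f, ψ, hψ, hpt⟩ : ∃ (f : X →L[ℝ] ℝ) (ψ : ℕ → ℕ), StrictMono ψ ∧
      ∀ x, Tendsto (fun n => y' (ψ n) x) atTop (𝓝 (f x)) := by
    obtain ⟨f, -, ψ, hψ, hlim⟩ := WeakDual.isSeqCompact_closedBall ℝ X (0 : StrongDual ℝ X) M
      (x := fun n => StrongDual.toWeakDual (y' n))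
      (fun n => (mem_closedBall_zero_iff (E := StrongDual ℝ X)).2 (hM n))
    exact ⟨WeakDual.toStrongDual f, ψ, hψ, fun x =>
      ((WeakDual.eval_continuous (𝕜 := ℝ) x).tendsto _).comp hlim⟩
  obtain ⟨b, hb⟩ := hdec f
  have hb0 : b ≠ 0 := by
    rintro rfl
    rw [zero_smul, sub_zero] at hb
    refine hnwc ⟨ψ, hψ, f, fun F => ?_⟩
    obtain ⟨x, hx⟩ := hpre F
    rw [hx f hb]
    exact (hpt x).congr fun n => (hx _ (hmem _)).symm
  obtain ⟨w, hw⟩ : ∃ w : ℕ → X →L[ℝ] ℝ, ∀ n, w n = y' (ψ n) - (f - b • S) := ⟨_, fun _ => rfl⟩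
  have hwY : ∀ n, w n ∈ (Submodule.span ℝ (Set.range u')).topologicalClosure := fun n => by
    rw [hw]; exact Submodule.sub_mem _ (hmem _) hb
  have hA : ∀ m, Tendsto (fun n => ‖(w n - b • S).comp (P m)‖) atTop (𝓝 0) := by
    intro m
    have h1 : ∀ n, (w n - b • S).comp (P m) =
        ∑ i ∈ Finset.range m, (y' (ψ n) (u i) - f (u i)) • u' i := by
      intro n
      rw [JT.comp_P e u hJ u' hu' P hP, hw]
      refine Finset.sum_congr rfl fun i _ => ?_
      congr 1
      simp only [ContinuousLinearMap.sub_apply]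
      ring
    have h2 : Tendsto (fun n => ∑ i ∈ Finset.range m, (y' (ψ n) (u i) - f (u i)) • u' i) atTop
        (𝓝 (∑ i ∈ Finset.range m, (0 : ℝ) • u' i)) := by
      refine tendsto_finsetSum _ fun i _ => ?_
      refine Tendsto.smul_const ?_ _
      simpa using (hpt (u i)).sub_const (f (u i))
    have h3 := h2.norm
    simp only [zero_smul, Finset.sum_const_zero, norm_zero] at h3
    exact h3.congr fun n => by rw [h1]
  have hB : ∀ n, Tendsto (fun m => ‖w n - (w n).comp (P m)‖) atTop (𝓝 0) := fun n =>
    JT.Y_tail e he1 u hJ u' hu' P hP (w n) (hwY n)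
  have hstep : ∀ (i : ℕ) (s : ℕ × ℕ), ∃ t : ℕ × ℕ, s.1 < t.1 ∧ s.2 < t.2 ∧
      ‖(w t.1 - b • S).comp (P s.2)‖ < 1 / ((i : ℝ) + 1) ∧
      ‖w t.1 - (w t.1).comp (P t.2)‖ < 1 / ((i : ℝ) + 1) := by
    intro i s
    have hpos : (0 : ℝ) < 1 / ((i : ℝ) + 1) := by positivity
    obtain ⟨n, hn1, hn2⟩ :=
      (((hA s.2).eventually (gt_mem_nhds hpos)).and (eventually_gt_atTop s.1)).exists
    obtain ⟨m, hm1, hm2⟩ :=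
      (((hB n).eventually (gt_mem_nhds hpos)).and (eventually_gt_atTop s.2)).exists
    exact ⟨(n, m), hn2, hm2, hn1, hm1⟩
  choose g hg1 hg2 hg3 hg4 using hstep
  obtain ⟨s, hs0, hs⟩ : ∃ s : ℕ → ℕ × ℕ, s 0 = (0, 0) ∧ ∀ i, s (i + 1) = g i (s i) :=
    ⟨fun n => Nat.rec (0, 0) g n, rfl, fun _ => rfl⟩
  refine ⟨fun i => ψ (s (i + 1)).1, ?_, f - b • S, hb, fun i => (s i).2, by simp only [hs0], ?_,
    fun i => (w (s (i + 1)).1).comp (P (s (i + 1)).2) - (w (s (i + 1)).1).comp (P (s i).2),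
    ?_, b, hb0, ?_⟩
  · refine hψ.comp (strictMono_nat_of_lt_succ fun i => ?_)
    rw [hs (i + 1)]; exact hg1 _ _
  · refine strictMono_nat_of_lt_succ fun i => ?_
    rw [hs i]; exact hg2 _ _
  · intro i
    have hlt : (s i).2 ≤ (s (i + 1)).2 := by rw [hs i]; exact (hg2 _ _).le
    simp only
    rw [JT.comp_P e u hJ u' hu' P hP, JT.comp_P e u hJ u' hu' P hP,
      ← Finset.sum_Ico_eq_sub _ hlt]
    refine Submodule.sum_mem _ fun j hj => Submodule.smul_mem _ _ (Submodule.subset_span ?_)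
    exact ⟨j, by simpa using hj, rfl⟩
  · refine squeeze_zero (g := fun i : ℕ => 1 / ((i : ℝ) + 1) + 1 / ((i : ℝ) + 1))
      (fun i => norm_nonneg _) (fun i => ?_) ?_
    · have h1 := hg3 i (s i)
      have h2 := hg4 i (s i)
      rw [← hs] at h1 h2
      have h3 : y' (ψ (s (i + 1)).1) - (f - b • S) - b • (S.comp (P (s i).2)) -
          ((w (s (i + 1)).1).comp (P (s (i + 1)).2) - (w (s (i + 1)).1).comp (P (s i).2)) =
          (w (s (i + 1)).1 - b • S).comp (P (s i).2) +
          (w (s (i + 1)).1 - (w (s (i + 1)).1).comp (P (s (i + 1)).2)) := by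
        rw [← hw, ContinuousLinearMap.sub_comp, ContinuousLinearMap.smul_comp]
        abel
      rw [h3]
      exact (norm_add_le _ _).trans (by linarith)
    · have := (tendsto_one_div_add_atTop_nhds_zero_nat (𝕜 := ℝ)).add
        (tendsto_one_div_add_atTop_nhds_zero_nat (𝕜 := ℝ))
      simpa using this
end
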